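/- arXiv:0811.4067 — 10 statements merged into one kernel-verified Lean document; each statement's English description precedes it below -/
import Mathlib

section
/- The invariant subalgebra S^{GL_n(ℂ)} is equal to the ℂ-subalgebra of S generated by the quadratic elements {q_{a,b} : a,b ∈ ℕ}. -/
open MvPolynomial

noncomputable section

/-- `S = Sym(⨁_{k≥0}(V_k ⊕ V*_k))`: the polynomial ring on variables
`x_{i,k}` (encoded `Sum.inl (i,k)`) and `x'_{i,k}` (encoded `Sum.inr (i,k)`). -/
abbrev SS (n : ℕ) : Type := MvPolynomial ((Fin n × ℕ) ⊕ (Fin n × ℕ)) ℂ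

/-- The quadratic invariant `q_{a,b} = Σ_{i=1}^n x_{i,a}·x'_{i,b}`. -/
def q (n a b : ℕ) : SS n :=
  ∑ i : Fin n, (X (Sum.inl (i, a)) : SS n) * X (Sum.inr (i, b))

/-- The action of `g ∈ GL_n(ℂ)` on `S` by ℂ-algebra endomorphisms (in fact
automorphisms): `g·x_{j,k} = Σ_i g_{ij} x_{i,k}` and `g·x'_{j,k} = Σ_i (g⁻¹)_{ji} x'_{i,k}`. -/
def act (n : ℕ) (g : GL (Fin n) ℂ) : SS n →ₐ[ℂ] SS n :=
  MvPolynomial.aeval fun v =>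
    match v with
    | Sum.inl (j, k) =>
        ∑ i : Fin n, ((g : Matrix (Fin n) (Fin n) ℂ) i j) • (X (Sum.inl (i, k)) : SS n)
    | Sum.inr (j, k) =>
        ∑ i : Fin n, (((g⁻¹ : GL (Fin n) ℂ) : Matrix (Fin n) (Fin n) ℂ) j i) •
          (X (Sum.inr (i, k)) : SS n)


namespace FFT

/-- variable type -/
abbrev Vr (n : ℕ) : Type := (Fin n × ℕ) ⊕ (Fin n × ℕ)

/-- the polarization operators -/
def D (n a b : ℕ) : Derivation ℂ (SS n) (SS n) :=
  ∑ i : Fin n, (X (Sum.inl (i, a)) : SS n) • pderiv (Sum.inl (i, b))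

lemma D_apply (n a b : ℕ) (f : SS n) :
    D n a b f = ∑ i : Fin n, (X (Sum.inl (i, a)) : SS n) * pderiv (Sum.inl (i, b)) f := by
  have : ∀ s : Finset (Fin n), (∑ i ∈ s, (X (Sum.inl (i, a)) : SS n) •
      (pderiv (Sum.inl (i, b)) : Derivation ℂ (SS n) (SS n))) f =
      ∑ i ∈ s, (X (Sum.inl (i, a)) : SS n) * pderiv (Sum.inl (i, b)) f := by
    classical
    intro s
    induction s using Finset.induction_on with
    | empty => simp
    | insert i s hi ih => rw [Finset.sum_insert hi, Finset.sum_insert hi, Derivation.add_apply, ih]; rfl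
  exact this _

lemma D_inl (n a b : ℕ) (i : Fin n) (k : ℕ) :
    D n a b (X (Sum.inl (i, k))) = if k = b then X (Sum.inl (i, a)) else 0 := by
  classical
  rw [D_apply]
  simp only [pderiv_X, Pi.single_apply, Sum.inl.injEq, Prod.mk.injEq, mul_ite, mul_one, mul_zero]
  split_ifs with h
  · subst h; simp
  · apply Finset.sum_eq_zero
    intro j _
    rw [if_neg]
    rintro ⟨_, h2⟩
    exact h h2

lemma D_inr (n a b : ℕ) (i : Fin n) (k : ℕ) :
    D n a b (X (Sum.inr (i, k))) = 0 := by
  classical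
  rw [D_apply]
  simp [pderiv_X]

lemma act_inl (n : ℕ) (g : GL (Fin n) ℂ) (j : Fin n) (k : ℕ) :
    act n g (X (Sum.inl (j, k))) =
      ∑ i : Fin n, ((g : Matrix (Fin n) (Fin n) ℂ) i j) • (X (Sum.inl (i, k)) : SS n) := by
  simp [act]

lemma act_inr (n : ℕ) (g : GL (Fin n) ℂ) (j : Fin n) (k : ℕ) :
    act n g (X (Sum.inr (j, k))) =
      ∑ i : Fin n, (((g⁻¹ : GL (Fin n) ℂ) : Matrix (Fin n) (Fin n) ℂ) j i) •
          (X (Sum.inr (i, k)) : SS n) := by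
  simp [act]

lemma D_act (n a b : ℕ) (g : GL (Fin n) ℂ) (f : SS n) :
    D n a b (act n g f) = act n g (D n a b f) := by
  induction f using MvPolynomial.induction_on with
  | C c => simp [← algebraMap_eq]
  | add p r hp hr => simp only [map_add, hp, hr]
  | mul_X p v hp =>
    have hv : D n a b (act n g (X v)) = act n g (D n a b (X v)) := by
      rcases v with ⟨i, k⟩ | ⟨i, k⟩
      · rw [act_inl, D_inl]
        simp only [map_sum, Derivation.map_smul, D_inl]
        split_ifs with h
        · rw [act_inl]
        · simp
      · rw [act_inr, D_inr]
        simp only [map_sum, Derivation.map_smul, D_inr]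
        simp
    simp only [map_mul, Derivation.leibniz, smul_eq_mul, map_add, hp, hv]

lemma act_q (n a b : ℕ) (g : GL (Fin n) ℂ) : act n g (q n a b) = q n a b := by
  have hg : ((g : Matrix (Fin n) (Fin n) ℂ) * ((g⁻¹ : GL (Fin n) ℂ) : Matrix (Fin n) (Fin n) ℂ)) = 1 := by
    rw [← Units.val_mul]; simp
  simp only [q, map_sum, map_mul, act_inl, act_inr, Finset.sum_mul_sum]
  rw [Finset.sum_comm]
  refine Finset.sum_congr rfl fun j _ => ?_
  rw [Finset.sum_comm]
  have : ∀ k : Fin n, ∑ i : Fin n, ((g : Matrix (Fin n) (Fin n) ℂ) j i) • (X (Sum.inl (j, a)) : SS n) *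
      (((g⁻¹ : GL (Fin n) ℂ) : Matrix (Fin n) (Fin n) ℂ) i k) • (X (Sum.inr (k, b)) : SS n) =
      (if j = k then (1 : ℂ) else 0) • ((X (Sum.inl (j, a)) : SS n) * X (Sum.inr (k, b))) := by
    intro k
    have h := congrFun (congrFun hg j) k
    rw [Matrix.mul_apply, Matrix.one_apply] at h
    rw [← h, Finset.sum_smul]
    refine Finset.sum_congr rfl fun i _ => ?_
    rw [smul_mul_smul_comm]
  simp only [this]
  simp

/-- the algebra generated by the q -/
def CC (n : ℕ) : Subalgebra ℂ (SS n) :=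
  Algebra.adjoin ℂ (Set.range fun ab : ℕ × ℕ => q n ab.1 ab.2)

lemma q_mem (n a b : ℕ) : q n a b ∈ CC n := Algebra.subset_adjoin ⟨(a, b), rfl⟩

lemma act_CC (n : ℕ) (g : GL (Fin n) ℂ) {f : SS n} (hf : f ∈ CC n) : act n g f = f := by
  induction hf using Algebra.adjoin_induction with
  | mem x hx => obtain ⟨ab, rfl⟩ := hx; exact act_q _ _ _ _
  | algebraMap r => exact AlgHom.commutes _ _
  | add x y _ _ hx hy => rw [map_add, hx, hy]
  | mul x y _ _ hx hy => rw [map_mul, hx, hy]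

lemma D_q (n a b c d : ℕ) : D n a b (q n c d) = if c = b then q n a d else 0 := by
  simp only [q, map_sum, Derivation.leibniz, D_inl, D_inr, smul_eq_mul]
  split_ifs with h
  · simp [mul_comm]
  · simp

lemma D_CC (n a b : ℕ) {f : SS n} (hf : f ∈ CC n) : D n a b f ∈ CC n := by
  induction hf using Algebra.adjoin_induction with
  | mem x hx =>
    obtain ⟨ab, rfl⟩ := hx
    simp only [D_q]
    split_ifs
    · exact q_mem _ _ _
    · exact zero_mem _
  | algebraMap r => rw [Derivation.map_algebraMap]; exact zero_mem _
  | add x y _ _ hx hy => rw [map_add]; exact add_mem hx hy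
  | mul x y hx0 hy0 hx hy =>
    rw [Derivation.leibniz]
    exact add_mem (mul_mem hx0 hy) (mul_mem hy0 hx)

lemma D_support (n a b : ℕ) (f : SS n) (m : Vr n →₀ ℕ) (h : coeff m (D n a b f) ≠ 0) :
    ∃ (i : Fin n) (m' : Vr n →₀ ℕ), m = Finsupp.single (Sum.inl (i, a)) 1 + m' ∧
      coeff (m' + Finsupp.single (Sum.inl (i, b)) 1) f ≠ 0 := by
  classical
  rw [D_apply, coeff_sum] at h
  obtain ⟨i, _, hi⟩ := Finset.exists_ne_zero_of_sum_ne_zero h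
  rw [← mem_support_iff, support_X_mul, Finset.mem_map] at hi
  obtain ⟨m', hm', rfl⟩ := hi
  refine ⟨i, m', rfl, ?_⟩
  rw [mem_support_iff, coeff_pderiv] at hm'
  exact left_ne_zero_of_mul hm'

/-- early case -/
lemma early (n : ℕ) (u : SS n) (hu : ∀ g, act n g u = u)
    (he : ∀ (i : Fin n) (k : ℕ), n ≤ k → Sum.inl (i, k) ∉ u.vars) : u ∈ CC n := by
  classical
  let φ : Vr n → SS n := fun v => match v with
    | Sum.inl (i, k) => if (i : ℕ) = k then 1 else 0
    | Sum.inr (i, k) => q n i k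
  have hmem : ∀ f : SS n, aeval φ f ∈ CC n := by
    intro f
    induction f using MvPolynomial.induction_on with
    | C c => rw [← algebraMap_eq, AlgHom.commutes]; exact algebraMap_mem _ _
    | add p r hp hr => rw [map_add]; exact add_mem hp hr
    | mul_X p v hp =>
      rw [map_mul, aeval_X]
      refine mul_mem hp ?_
      rcases v with ⟨i, k⟩ | ⟨i, k⟩
      · simp only [φ]; split_ifs
        · exact one_mem _
        · exact zero_mem _
      · exact q_mem _ _ _
  let A : Matrix (Fin n) (Fin n) (SS n) := fun i j => X (Sum.inl (i, (j : ℕ)))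
  have key : A.det * (aeval φ u - u) = 0 := by
    apply MvPolynomial.funext
    intro z
    let A0 : Matrix (Fin n) (Fin n) ℂ := fun i j => z (Sum.inl (i, (j : ℕ)))
    have hA : eval z A.det = A0.det := by
      rw [RingHom.map_det]; congr 1; ext i j; rw [RingHom.mapMatrix_apply, Matrix.map_apply]; exact eval_X _
    rw [map_mul, hA, map_zero]
    by_cases hd : A0.det = 0
    · rw [hd, zero_mul]
    have hd' : IsUnit A0.transpose.det := by rw [Matrix.det_transpose]; exact isUnit_iff_ne_zero.mpr hd
    let gi : GL (Fin n) ℂ := Matrix.GeneralLinearGroup.mk'' A0.transpose hd'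
    have hgi : (gi : Matrix (Fin n) (Fin n) ℂ) = A0.transpose := rfl
    have hmul : ((gi : Matrix (Fin n) (Fin n) ℂ) * ((gi⁻¹ : GL (Fin n) ℂ) : Matrix (Fin n) (Fin n) ℂ)) = 1 := by
      rw [← Units.val_mul]; simp
    have hmul2 : (((gi⁻¹ : GL (Fin n) ℂ) : Matrix (Fin n) (Fin n) ℂ)).transpose * A0 = 1 := by
      have := congrArg Matrix.transpose hmul
      rwa [Matrix.transpose_mul, hgi, Matrix.transpose_transpose, Matrix.transpose_one] at this
    have e1 : eval z (aeval φ u) = eval z (act n gi⁻¹ u) := by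
      refine hom_congr_vars (f₁ := (eval z).comp (aeval φ : SS n →ₐ[ℂ] SS n).toRingHom)
        (f₂ := (eval z).comp (act n gi⁻¹).toRingHom) ?_ ?_ rfl
      · apply RingHom.ext; intro c
        change eval z (aeval φ (C c)) = eval z (act n gi⁻¹ (C c))
        rw [← algebraMap_eq, AlgHom.commutes, AlgHom.commutes]
      · intro v hv _
        rcases v with ⟨i, k⟩ | ⟨i, k⟩
        · have hk : k < n := by
            by_contra hk
            exact he i k (not_lt.mp hk) hv
          have h := congrFun (congrFun hmul2 i) ⟨k, hk⟩
          rw [Matrix.mul_apply, Matrix.one_apply] at h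
          simp only [Matrix.transpose_apply, A0] at h
          simp only [RingHom.comp_apply, AlgHom.toRingHom_eq_coe, RingHom.coe_coe, aeval_X, act_inl,
            map_sum, smul_eval, eval_X, φ]
          rw [h]
          simp only [Fin.ext_iff]
          split_ifs <;> simp
        · simp only [RingHom.comp_apply, AlgHom.toRingHom_eq_coe, RingHom.coe_coe, aeval_X, act_inr,
            map_sum, smul_eval, eval_X, φ, q, map_mul, inv_inv, hgi]
          rfl
    rw [map_sub, e1, hu, sub_self, mul_zero]
  have hdet : A.det ≠ 0 := by
    intro h
    have h2 := congrArg (eval fun v : Vr n => match v with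
      | Sum.inl (i, k) => if (i : ℕ) = k then (1 : ℂ) else 0
      | Sum.inr _ => 0) h
    rw [RingHom.map_det, map_zero] at h2
    have h3 : (RingHom.mapMatrix (eval fun v : Vr n => match v with
      | Sum.inl (i, k) => if (i : ℕ) = k then (1 : ℂ) else 0
      | Sum.inr _ => 0)) A = 1 := by
      ext i j
      rw [RingHom.mapMatrix_apply, Matrix.map_apply]
      simp only [A, Matrix.one_apply, Fin.ext_iff, eval_X]
    rw [h3, Matrix.det_one] at h2
    exact one_ne_zero h2
  have := (mul_eq_zero.mp key).resolve_left hdet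
  rw [← sub_eq_zero.mp this]
  exact hmem u

lemma late_free (n : ℕ) (u : SS n) (h : ∀ a b, a < n → n ≤ b → D n a b u = 0) :
    ∀ (i : Fin n) (k : ℕ), n ≤ k → Sum.inl (i, k) ∉ u.vars := by
  classical
  intro i k hk
  let A : Matrix (Fin n) (Fin n) (SS n) := fun j i => X (Sum.inl (i, (j : ℕ)))
  have hdet : A.det ≠ 0 := by
    intro h
    have h2 := congrArg (eval fun v : Vr n => match v with
      | Sum.inl (i, k) => if (i : ℕ) = k then (1 : ℂ) else 0
      | Sum.inr _ => 0) h
    rw [RingHom.map_det, map_zero] at h2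
    have h3 : (RingHom.mapMatrix (eval fun v : Vr n => match v with
      | Sum.inl (i, k) => if (i : ℕ) = k then (1 : ℂ) else 0
      | Sum.inr _ => 0)) A = 1 := by
      ext i j
      rw [RingHom.mapMatrix_apply, Matrix.map_apply]
      simp only [A, Matrix.one_apply, Fin.ext_iff, eval_X, eq_comm]
    rw [h3, Matrix.det_one] at h2
    exact one_ne_zero h2
  have h0 : A.mulVec (fun i => pderiv (Sum.inl (i, k)) u) = 0 := by
    ext1 j
    have := h j k j.2 hk
    rw [D_apply] at this
    simpa [Matrix.mulVec, dotProduct, A] using this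
  have h1 := congrFun (Matrix.eq_zero_of_mulVec_eq_zero hdet h0) i
  simp only [Pi.zero_apply] at h1
  intro hv
  rw [mem_vars_iff_mem_support] at hv
  obtain ⟨m, hm, hmv⟩ := hv
  have hm1 : m = (m - Finsupp.single (Sum.inl (i, k)) 1) + Finsupp.single (Sum.inl (i, k)) 1 := by
    rw [tsub_add_cancel_of_le]
    rw [Finsupp.single_le_iff]
    exact Nat.one_le_iff_ne_zero.mpr (Finsupp.mem_support_iff.mp hmv)
  have h2 := congrArg (coeff (m - Finsupp.single (Sum.inl (i, k)) 1)) h1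
  rw [coeff_pderiv, ← hm1, coeff_zero] at h2
  rcases mul_eq_zero.mp h2 with h3 | h3
  · exact (mem_support_iff.mp hm) h3
  · exact Nat.cast_add_one_ne_zero _ h3

/-- product of factorials -/
def wt {n : ℕ} (m : Vr n →₀ ℕ) : ℝ := m.prod fun _ k => (k.factorial : ℝ)

lemma wt_pos {n : ℕ} (m : Vr n →₀ ℕ) : 0 < wt m :=
  Finset.prod_pos fun _ _ => Nat.cast_pos.mpr (Nat.factorial_pos _)

lemma wt_single {n : ℕ} (v : Vr n) (m : Vr n →₀ ℕ) :
    wt (Finsupp.single v 1 + m) = (m v + 1) * wt m := by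
  classical
  have h1 : (Finsupp.single v 1 + m).support ⊆ insert v m.support := by
    intro t ht
    rw [Finset.mem_insert]
    by_contra hcon
    rw [not_or, Finsupp.notMem_support_iff] at hcon
    rw [Finsupp.mem_support_iff, Finsupp.add_apply, hcon.2,
      Finsupp.single_eq_of_ne hcon.1] at ht
    exact ht rfl
  unfold wt
  rw [Finsupp.prod_of_support_subset _ h1 _ (by simp),
    Finsupp.prod_of_support_subset m (Finset.subset_insert v m.support) _ (by simp)]
  have : ∀ t ∈ insert v m.support, ((((Finsupp.single v 1 + m : Vr n →₀ ℕ)) t).factorial : ℝ) =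
      (if t = v then (m v + 1 : ℝ) else 1) * ((m t).factorial : ℝ) := by
    intro t _
    by_cases h : t = v
    · subst h
      simp only [Finsupp.add_apply, Finsupp.single_eq_same, if_true]
      rw [add_comm 1, Nat.factorial_succ]
      push_cast
      ring
    · simp [Finsupp.single_eq_of_ne h, h]
  rw [Finset.prod_congr rfl this, Finset.prod_mul_distrib]
  congr 1
  simp

/-- the Fischer pairing, as a function -/
def fB {n : ℕ} (f g : SS n) : ℝ :=
  ∑ m ∈ f.support, wt m * (coeff m f * star (coeff m g)).re

lemma fB_eq {n : ℕ} (f g : SS n) (T : Finset (Vr n →₀ ℕ)) (hT : f.support ⊆ T) :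
    fB f g = ∑ m ∈ T, wt m * (coeff m f * star (coeff m g)).re := by
  refine Finset.sum_subset hT fun m _ hm => ?_
  rw [notMem_support_iff.mp hm]; simp

lemma fB_symm {n : ℕ} (f g : SS n) : fB f g = fB g f := by
  classical
  rw [fB_eq f g _ Finset.subset_union_left, fB_eq g f (f.support ∪ g.support) Finset.subset_union_right]
  refine Finset.sum_congr rfl fun m _ => ?_
  congr 1
  simp [Complex.mul_re]; ring

lemma fB_add_right {n : ℕ} (f g h : SS n) : fB f (g + h) = fB f g + fB f h := by
  unfold fB
  rw [← Finset.sum_add_distrib]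
  refine Finset.sum_congr rfl fun m _ => ?_
  rw [coeff_add, star_add, mul_add, Complex.add_re, mul_add]

lemma fB_smul_right {n : ℕ} (r : ℝ) (f g : SS n) : fB f (r • g) = r * fB f g := by
  unfold fB
  rw [Finset.mul_sum]
  refine Finset.sum_congr rfl fun m _ => ?_
  rw [coeff_smul]
  simp [Complex.mul_re]; ring

/-- the Fischer pairing -/
def B (n : ℕ) : SS n →ₗ[ℝ] SS n →ₗ[ℝ] ℝ :=
  LinearMap.mk₂ ℝ fB
    (fun f g h => by rw [fB_symm, fB_add_right, fB_symm h f, fB_symm h g])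
    (fun r f g => by rw [fB_symm, fB_smul_right, fB_symm g f, smul_eq_mul])
    fB_add_right (fun r f g => by rw [fB_smul_right, smul_eq_mul])

lemma B_apply {n : ℕ} (f g : SS n) : B n f g = fB f g := rfl

lemma B_symm {n : ℕ} (f g : SS n) : B n f g = B n g f := fB_symm f g

lemma B_self {n : ℕ} (f : SS n) (h : B n f f = 0) : f = 0 := by
  rw [B_apply, fB, Finset.sum_eq_zero_iff_of_nonneg] at h
  · ext m
    rw [coeff_zero]
    by_contra hm
    have h1 := h m (mem_support_iff.mpr hm)
    rcases mul_eq_zero.mp h1 with h2 | h2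
    · exact (wt_pos m).ne' h2
    · apply hm
      rw [Complex.star_def, Complex.mul_conj, Complex.ofReal_re] at h2
      exact Complex.normSq_eq_zero.mp h2
  · intro m _
    refine mul_nonneg (wt_pos m).le ?_
    rw [Complex.star_def, Complex.mul_conj, Complex.ofReal_re]
    exact Complex.normSq_nonneg _

lemma B_X {n : ℕ} (v : Vr n) (f g : SS n) : B n (X v * f) g = B n f (pderiv v g) := by
  rw [B_apply, B_apply, fB, fB, support_X_mul, Finset.sum_map]
  refine Finset.sum_congr rfl fun m _ => ?_
  rw [addLeftEmbedding_apply, coeff_X_mul, wt_single, coeff_pderiv, add_comm m]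
  have : star (coeff (Finsupp.single v 1 + m) g * ((m v : ℂ) + 1)) =
      ((m v + 1 : ℝ) : ℂ) * star (coeff (Finsupp.single v 1 + m) g) := by
    simp [mul_comm]
  rw [this, mul_left_comm, Complex.re_ofReal_mul]
  ring

lemma B_D (n a b : ℕ) (f g : SS n) : B n (D n a b f) g = B n f (D n b a g) := by
  rw [D_apply, D_apply, map_sum, map_sum, LinearMap.sum_apply]
  refine Finset.sum_congr rfl fun i _ => ?_
  rw [B_X, B_symm, ← B_X, B_symm]

/-- orthogonal projection -/
lemma exists_proj {n : ℕ} (K : Submodule ℝ (SS n)) [FiniteDimensional ℝ K] (p : SS n) :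
    ∃ c ∈ K, ∀ k ∈ K, B n (p - c) k = 0 := by
  let L : K →ₗ[ℝ] Module.Dual ℝ K := (B n).domRestrict₁₂ K K
  have hinj : Function.Injective L := by
    rw [injective_iff_map_eq_zero]
    intro x hx
    have := LinearMap.congr_fun hx x
    exact Subtype.ext (B_self _ this)
  have hsurj : Function.Surjective L :=
    (LinearMap.injective_iff_surjective_of_finrank_eq_finrank
      (Subspace.dual_finrank_eq (K := ℝ) (V := K)).symm).mp hinj
  obtain ⟨c, hc⟩ := hsurj ((B n p).domRestrict K)
  refine ⟨c, c.2, fun k hk => ?_⟩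
  have h : B n c k = B n p k := LinearMap.congr_fun hc ⟨k, hk⟩
  rw [map_sub, LinearMap.sub_apply, h, sub_self]

/-- index of a variable -/
def idx {n : ℕ} : Vr n → ℕ := fun v => match v with
  | Sum.inl (_, k) => k
  | Sum.inr (_, k) => k

/-- the monomials allowed -/
def MM (n M d : ℕ) : Set (Vr n →₀ ℕ) :=
  {m | m.degree ≤ d ∧ ∀ v, m v ≠ 0 → idx v < M}

lemma MM_finite (n M d : ℕ) : (MM n M d).Finite := by
  classical
  let T : Finset (Vr n) := (Finset.univ ×ˢ Finset.range M).disjSum (Finset.univ ×ˢ Finset.range M)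
  refine (Set.finite_Icc 0 (∑ v ∈ T, Finsupp.single v d)).subset ?_
  rintro m ⟨hm, hv⟩
  refine ⟨zero_le, ?_⟩
  intro v
  by_cases h : m v = 0
  · rw [h]; exact Nat.zero_le _
  have h1 := hv v h
  have hT : v ∈ T := by
    rcases v with ⟨i, k⟩ | ⟨i, k⟩
    · simpa [T, idx] using h1
    · simpa [T, idx] using h1
  rw [Finsupp.finsetSum_apply]
  refine ((Finsupp.le_degree v m).trans hm).trans ?_
  refine le_trans ?_ (Finset.single_le_sum (fun _ _ => Nat.zero_le _) hT)
  simp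

/-- the finite dimensional piece -/
def FF (n M d : ℕ) : Submodule ℂ (SS n) where
  carrier := {f | ∀ m, coeff m f ≠ 0 → m ∈ MM n M d}
  zero_mem' := by intro m hm; simp at hm
  add_mem' := by
    intro f g hf hg m hm
    by_cases h : coeff m f = 0
    · refine hg m fun h' => hm ?_
      rw [coeff_add, h, h', add_zero]
    · exact hf m h
  smul_mem' := by
    intro c f hf m hm
    refine hf m fun h' => hm ?_
    rw [coeff_smul, h', smul_zero]

lemma FF_finite (n M d : ℕ) : FiniteDimensional ℂ (FF n M d) := by
  have hfin : ((fun m => monomial m (1 : ℂ)) '' MM n M d : Set (SS n)).Finite := (MM_finite n M d).image _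
  have : FiniteDimensional ℂ (Submodule.span ℂ ((fun m => monomial m (1 : ℂ)) '' MM n M d : Set (SS n))) :=
    FiniteDimensional.span_of_finite ℂ hfin
  refine Submodule.finiteDimensional_of_le (S₂ := Submodule.span ℂ ((fun m => monomial m (1 : ℂ)) '' MM n M d : Set (SS n))) ?_
  intro f hf
  rw [f.as_sum]
  refine Submodule.sum_mem _ fun m hm => ?_
  have : monomial m (coeff m f) = (coeff m f) • (monomial m (1 : ℂ) : SS n) := by
    rw [smul_monomial, smul_eq_mul, mul_one]
  rw [this]
  exact Submodule.smul_mem _ _ (Submodule.subset_span ⟨m, hf m (mem_support_iff.mp hm), rfl⟩)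

lemma D_FF (n M d a b : ℕ) (ha : a < M) (f : SS n) (hf : f ∈ FF n M d) : D n a b f ∈ FF n M d := by
  classical
  intro m hm
  obtain ⟨i, m', rfl, h⟩ := D_support n a b f m hm
  obtain ⟨h1, h2⟩ := hf _ h
  refine ⟨?_, ?_⟩
  · rw [map_add, Finsupp.degree_single] at h1 ⊢
    omega
  · intro v hv
    by_cases hva : v = Sum.inl (i, a)
    · subst hva; exact ha
    · apply h2 v
      rw [Finsupp.add_apply, Finsupp.single_eq_of_ne hva, zero_add] at hv
      rw [Finsupp.add_apply]
      omega

/-- late weight -/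
def lw (n : ℕ) : Vr n → ℕ := fun v => match v with
  | Sum.inl (_, k) => if k < n then 0 else 1
  | Sum.inr _ => 0

lemma step (n M d : ℕ) (hM : n ≤ M) (N : ℕ) : ∀ u : SS n, (∀ g, act n g u = u) → u ∈ FF n M d →
    (∀ c ∈ CC n, c ∈ FF n M d → B n u c = 0) →
    (∀ m, coeff m u ≠ 0 → Finsupp.weight (lw n) m < N) → u = 0 := by
  induction N with
  | zero =>
    intro u _ _ _ h
    ext m
    by_contra hm
    exact Nat.not_lt_zero _ (h m hm)
  | succ N ih =>
    intro u hu hF hC hN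
    have hD : ∀ a b, a < n → n ≤ b → D n a b u = 0 := by
      intro a b ha hb
      by_cases hbM : b < M
      · apply ih
        · intro g
          rw [← D_act, hu]
        · exact D_FF _ _ _ _ _ (ha.trans_le hM) _ hF
        · intro c hc hcF
          rw [B_D]
          exact hC _ (D_CC _ _ _ hc) (D_FF _ _ _ _ _ hbM _ hcF)
        · intro m hm
          obtain ⟨i, m', rfl, h⟩ := D_support n a b u m hm
          have h1 := hN _ h
          rw [map_add, Finsupp.weight_single] at h1 ⊢
          simp only [lw, ha, not_lt.mpr hb, if_true, if_false, smul_eq_mul] at h1 ⊢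
          omega
      · ext m
        by_contra hm
        rw [coeff_zero] at hm
        obtain ⟨i, m', rfl, h⟩ := D_support n a b u m hm
        exact hbM ((hF _ h).2 (Sum.inl (i, b)) (by simp))
    exact B_self u (hC u (early n u hu (late_free n u hD)) hF)

lemma main (n : ℕ) (p : SS n) (hp : ∀ g, act n g p = p) : p ∈ CC n := by
  classical
  let d := p.support.sup fun m => m.degree
  let M := n + (p.vars.sup idx + 1)
  have hpF : p ∈ FF n M d := by
    intro m hm
    have hm' := mem_support_iff.mpr hm
    refine ⟨Finset.le_sup (f := fun m : Vr n →₀ ℕ => m.degree) hm', fun v hv => ?_⟩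
    have hvv : v ∈ p.vars := (mem_vars_iff_mem_support v).mpr ⟨m, hm', Finsupp.mem_support_iff.mpr hv⟩
    have := Finset.le_sup (f := idx) hvv
    simp only [M]
    omega
  let K0 : Submodule ℂ (SS n) := (Subalgebra.toSubmodule (CC n)) ⊓ FF n M d
  have := FF_finite n M d
  have : FiniteDimensional ℂ K0 := Submodule.finiteDimensional_of_le (S₂ := FF n M d) inf_le_right
  have : FiniteDimensional ℝ (K0.restrictScalars ℝ) := by
    change Module.Finite ℝ K0
    exact Module.Finite.trans ℂ K0
  obtain ⟨c, hc, hk⟩ := exists_proj (K0.restrictScalars ℝ) p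
  have hc0 : c ∈ CC n := hc.1
  have hcF : c ∈ FF n M d := hc.2
  have h0 : p - c = 0 := by
    refine step n M d (Nat.le_add_right _ _) ((p - c).support.sup (fun m => Finsupp.weight (lw n) m) + 1) (p - c) ?_ (Submodule.sub_mem _ hpF hcF) ?_ ?_
    · intro g
      rw [map_sub, hp, act_CC n g hc0]
    · intro k hk1 hk2
      exact hk k ⟨hk1, hk2⟩
    · intro m hm
      exact Nat.lt_succ_of_le (Finset.le_sup (f := fun m => Finsupp.weight (lw n) m) (mem_support_iff.mpr hm))
  rw [sub_eq_zero.mp h0]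
  exact hc0

end FFT

/-- The invariant subalgebra `S^{GL_n(ℂ)}` is the ℂ-subalgebra of `S` generated by the
quadratic elements `q_{a,b}`, `a,b ∈ ℕ`. -/
theorem invariants_eq_adjoin_q (n : ℕ) (hn : 1 ≤ n) :
    {p : SS n | ∀ g : GL (Fin n) ℂ, act n g p = p} =
      (Algebra.adjoin ℂ (Set.range fun ab : ℕ × ℕ => q n ab.1 ab.2) : Set (SS n)) := by
  ext p
  exact ⟨fun hp => FFT.main n p hp, fun hp g => FFT.act_CC n g hp⟩
end
end

section
/- Let φ : R → S be the ℂ-algebra homomorphism determined by φ(Q_{a,b}) = q_{a,b} for all a,b ∈ ℕ. Then the kernel of φ is the ideal of R generated by the determinants d_{I,J} over all strictly increasing tuples I, J ∈ ℕ^{n+1}. -/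
open MvPolynomial

noncomputable section

/-- The polynomial ring `R = ℂ[Q_{a,b} : a,b ∈ ℕ]`. -/
abbrev RR : Type := MvPolynomial (ℕ × ℕ) ℂ

/-- The determinant `d_{I,J}` of the `(n+1)×(n+1)` matrix with `(r,s)` entry `Q_{i_r,j_s}`. -/
def dDet (n : ℕ) (I J : Fin (n + 1) → ℕ) : RR :=
  Matrix.det (Matrix.of fun r s => (X (I r, J s) : RR))

/-- The ℂ-algebra homomorphism `φ : R → S` with `φ(Q_{a,b}) = q_{a,b}`. -/
def φmap (n : ℕ) : RR →ₐ[ℂ] SS n :=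
  MvPolynomial.aeval fun ab : ℕ × ℕ => q n ab.1 ab.2


/-- weight of a matrix entry -/
def wt (p : ℕ × ℕ) : ℕ := ((p.1 : ℤ) - p.2).natAbs ^ 2

theorem wt_cast (p : ℕ × ℕ) : (wt p : ℤ) = ((p.1 : ℤ) - p.2) ^ 2 := by
  simp [wt]

/-- total weight of a monomial -/
def fw (m : ℕ × ℕ →₀ ℕ) : ℕ := Finsupp.weight wt m

theorem fw_add (a b : ℕ × ℕ →₀ ℕ) : fw (a + b) = fw a + fw b := by simp [fw]

theorem fw_single (p : ℕ × ℕ) : fw (Finsupp.single p 1) = wt p := by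
  simp [fw, Finsupp.weight_single]

theorem fw_sum {ι : Type*} (s : Finset ι) (g : ι → (ℕ × ℕ →₀ ℕ)) :
    fw (∑ i ∈ s, g i) = ∑ i ∈ s, fw (g i) := by simp [fw]

theorem exists_split {σ : Type*} (A : σ →₀ ℕ) (p : σ) (h : A p ≠ 0) :
    ∃ A', A = A' + Finsupp.single p 1 :=
  ⟨A - Finsupp.single p 1, (Finsupp.sub_add_single_one_cancel h).symm⟩

theorem mem_marg {α β : Type*} (f : α → β) (A : α →₀ ℕ) (b : β) :
    (A.mapDomain f) b ≠ 0 ↔ ∃ x, A x ≠ 0 ∧ f x = b := by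
  classical
  constructor
  · intro h
    have := Finsupp.mapDomain_support (f := f) (s := A) (Finsupp.mem_support_iff.2 h)
    simpa using this
  · rintro ⟨x, hx, rfl⟩
    obtain ⟨A', rfl⟩ := exists_split A x hx
    simp [Finsupp.mapDomain_add]

theorem chain_lemma (k : ℕ) : ∀ A B : ℕ × ℕ →₀ ℕ, B.degree = k →
    A.mapDomain Prod.fst = B.mapDomain Prod.fst →
    A.mapDomain Prod.snd = B.mapDomain Prod.snd →
    (∀ p q, B p ≠ 0 → B q ≠ 0 → p ≤ q ∨ q ≤ p) → A = B ∨ fw B < fw A := by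
  induction k with
  | zero =>
    intro A B hB h1 h2 hc
    have : B = 0 := by rwa [Finsupp.degree_eq_zero_iff] at hB
    subst this
    left
    ext p
    by_contra h
    have := (mem_marg Prod.fst A p.1).2 ⟨p, h, rfl⟩
    rw [h1] at this
    simp at this
  | succ k ih =>
    intro A B hB h1 h2 hc
    have hne : B.support.Nonempty := by
      rw [Finsupp.support_nonempty_iff]
      rintro rfl
      simp at hB
    obtain ⟨p, hp⟩ := B.support.exists_maximal hne
    have hpB : B p ≠ 0 := by simpa using hp.1
    have hmax : ∀ q, B q ≠ 0 → q ≤ p := by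
      intro q hq
      rcases hc q p hq hpB with h | h
      · exact h
      · exact hp.2 (by simpa using hq) h
    obtain ⟨B', rfl⟩ := exists_split B p hpB
    have hB' : B'.degree = k := by simpa using hB
    have hc' : ∀ p q, B' p ≠ 0 → B' q ≠ 0 → p ≤ q ∨ q ≤ p := by
      intro p q hp hq
      apply hc <;> simp <;> tauto
    -- coordinates in A are bounded
    have hA1 : ∀ x, A x ≠ 0 → x.1 ≤ p.1 := by
      intro x hx
      have := (mem_marg Prod.fst A x.1).2 ⟨x, hx, rfl⟩
      rw [h1, mem_marg] at this
      obtain ⟨y, hy, hy'⟩ := this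
      rw [← hy']
      exact (hmax y hy).1
    have hA2 : ∀ x, A x ≠ 0 → x.2 ≤ p.2 := by
      intro x hx
      have := (mem_marg Prod.snd A x.2).2 ⟨x, hx, rfl⟩
      rw [h2, mem_marg] at this
      obtain ⟨y, hy, hy'⟩ := this
      rw [← hy']
      exact (hmax y hy).2
    by_cases hpA : A p = 0
    · right
      obtain ⟨x, hx, hx1⟩ := (mem_marg Prod.fst A p.1).1 (by
        rw [h1, mem_marg]; exact ⟨p, hpB, rfl⟩)
      obtain ⟨y, hy, hy1⟩ := (mem_marg Prod.snd A p.2).1 (by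
        rw [h2, mem_marg]; exact ⟨p, hpB, rfl⟩)
      have hx2 : x.2 < p.2 := lt_of_le_of_ne (hA2 x hx) (by
        intro h; apply hx; rw [show x = p from Prod.ext hx1 h]; exact hpA)
      have hy2 : y.1 < p.1 := lt_of_le_of_ne (hA1 y hy) (by
        intro h; apply hy; rw [show y = p from Prod.ext h hy1]; exact hpA)
      have hxy : x ≠ y := by rintro rfl; omega
      obtain ⟨A1, rfl⟩ := exists_split A x hx
      have hy' : A1 y ≠ 0 := by
        simpa [Finsupp.single_apply, hxy] using hy
      obtain ⟨A2, rfl⟩ := exists_split A1 y hy'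
      have := ih (A2 + Finsupp.single (y.1, x.2) 1) B' hB' (by
          have h := h1
          simp only [Finsupp.mapDomain_add, Finsupp.mapDomain_single, hx1] at h ⊢
          exact add_right_cancel h) (by
          have h := h2
          simp only [Finsupp.mapDomain_add, Finsupp.mapDomain_single, hy1] at h ⊢
          rw [add_right_comm] at h
          exact add_right_cancel h) hc'
      have hle : fw B' ≤ fw (A2 + Finsupp.single (y.1, x.2) 1) := by
        rcases this with h | h
        · rw [h]
        · exact h.le
      simp only [fw_add, fw_single] at hle ⊢
      have key : wt (y.1, x.2) + wt p < wt x + wt y := by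
        zify
        simp only [wt_cast, hx1, hy1]
        have h1 : (x.2 : ℤ) < p.2 := by exact_mod_cast hx2
        have h2 : (y.1 : ℤ) < p.1 := by exact_mod_cast hy2
        nlinarith [mul_pos (sub_pos.2 h1) (sub_pos.2 h2)]
      omega
    · obtain ⟨A', rfl⟩ := exists_split A p hpA
      have := ih A' B' hB' (by
          simp only [Finsupp.mapDomain_add] at h1
          exact add_right_cancel h1) (by
          simp only [Finsupp.mapDomain_add] at h2
          exact add_right_cancel h2) hc'
      rcases this with h | h
      · left; rw [h]
      · right; simp only [fw_add]; omega

theorem mirsky (n : ℕ) : ∀ s : Finset (ℕ × ℕ),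
    (∃ col : ℕ × ℕ → ℕ, (∀ p ∈ s, col p < n) ∧
      ∀ p ∈ s, ∀ q ∈ s, col p = col q → p ≤ q ∨ q ≤ p) ∨
    ∃ a b : Fin (n + 1) → ℕ, StrictMono a ∧ StrictAnti b ∧ ∀ i, (a i, b i) ∈ s := by
  classical
  induction n with
  | zero =>
    intro s
    rcases s.eq_empty_or_nonempty with rfl | ⟨p, hp⟩
    · left; exact ⟨fun _ => 0, by simp, by simp⟩
    · right
      exact ⟨fun _ => p.1, fun _ => p.2, fun i j h => by omega, fun i j h => by omega,
        fun _ => hp⟩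
  | succ n ih =>
    intro s
    let P : ℕ × ℕ → Prop := fun p => ∃ q ∈ s, q.1 < p.1 ∧ p.2 < q.2
    rcases ih (s.filter P) with ⟨col, h1, h2⟩ | ⟨a, b, ha, hb, hab⟩
    · left
      refine ⟨fun p => if P p then col p else n, ?_, ?_⟩
      · intro p hp
        by_cases h : P p
        · simp only [h, if_true]
          have := h1 p (by simp [hp, h])
          omega
        · simp [h]
      · intro p hp q hq hpq
        by_cases h : P p <;> by_cases h' : P q
        · simp only [h, h', if_true] at hpq
          exact h2 p (by simp [hp, h]) q (by simp [hq, h']) hpq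
        · simp only [h, h', if_true, if_false] at hpq
          have := h1 p (by simp [hp, h])
          omega
        · simp only [h, h', if_true, if_false] at hpq
          have := h1 q (by simp [hq, h'])
          omega
        · have e1 : ¬ (q.1 < p.1 ∧ p.2 < q.2) := fun e => h ⟨q, hq, e⟩
          have e2 : ¬ (p.1 < q.1 ∧ q.2 < p.2) := fun e => h' ⟨p, hp, e⟩
          simp only [Prod.le_def]
          omega
    · right
      obtain ⟨q, hq, hq1, hq2⟩ := (Finset.mem_filter.1 (hab 0)).2
      refine ⟨Fin.cons q.1 a, Fin.cons q.2 b, ?_, ?_, ?_⟩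
      · rw [Fin.strictMono_iff_lt_succ]
        intro i
        refine Fin.cases ?_ (fun j => ?_) i
        · simpa using hq1
        · rw [← Fin.succ_castSucc]
          simp only [Fin.cons_succ]
          exact ha j.castSucc_lt_succ
      · rw [Fin.strictAnti_iff_succ_lt]
        intro i
        refine Fin.cases ?_ (fun j => ?_) i
        · simpa using hq2
        · rw [← Fin.succ_castSucc]
          simp only [Fin.cons_succ]
          exact hb j.castSucc_lt_succ
      · intro i
        refine Fin.cases ?_ (fun j => ?_) i
        · simpa using hq
        · simpa using (Finset.mem_filter.1 (hab j)).1

theorem rearr {n : ℕ} (a b : Fin n → ℕ) (ha : StrictMono a) (hb : StrictAnti b)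
    (τ : Equiv.Perm (Fin n)) (hτ : τ ≠ 1) :
    fw (∑ i, Finsupp.single (a (τ i), b i) 1) < fw (∑ i, Finsupp.single (a i, b i) 1) := by
  simp only [fw_sum, fw_single]
  have h := (Antivary.sum_mul_lt_sum_comp_perm_mul_iff (σ := τ)
    (f := fun i => (a i : ℤ)) (g := fun i => (b i : ℤ)) (by
      intro i j hij
      have : b i < b j := Int.ofNat_lt.1 hij
      have := hb.lt_iff_gt.1 this
      exact Int.ofNat_le.2 (ha this).le)).2 (by
      intro hv
      apply hτ
      have hm : StrictMono τ := by
        intro i j hij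
        have h1 := hv (i := j) (j := i) (Int.ofNat_lt.2 (hb hij))
        have h2 : a (τ i) ≤ a (τ j) := Int.ofNat_le.1 h1
        have h3 := ha.le_iff_le.1 h2
        exact lt_of_le_of_ne h3 (fun e => hij.ne (τ.injective e))
      ext i
      have : (τ : Fin n → Fin n) = id := hm.eq_id
      simp [this])
  zify
  simp only [wt_cast, sub_sq, Finset.sum_add_distrib, Finset.sum_sub_distrib]
  rw [Equiv.sum_comp τ (fun i => (a i : ℤ) ^ 2)]
  simp only [mul_assoc, ← Finset.mul_sum]
  linarith

/-- exponent vector of `x_{i,a} x'_{i,b}` -/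
def ee (n : ℕ) (i : Fin n) (p : ℕ × ℕ) : ((Fin n × ℕ) ⊕ (Fin n × ℕ)) →₀ ℕ :=
  Finsupp.single (Sum.inl (i, p.1)) 1 + Finsupp.single (Sum.inr (i, p.2)) 1

/-- exponent vector of a colored monomial -/
def sv (n : ℕ) (c : Fin n → (ℕ × ℕ →₀ ℕ)) : ((Fin n × ℕ) ⊕ (Fin n × ℕ)) →₀ ℕ :=
  ∑ i, Finsupp.weight (ee n i) (c i)

/-- the image of `φ` on monomials, with natural coefficients -/
def PN (n : ℕ) : MvPolynomial (ℕ × ℕ) ℕ →ₐ[ℕ] MvPolynomial ((Fin n × ℕ) ⊕ (Fin n × ℕ)) ℕ :=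
  MvPolynomial.aeval fun p : ℕ × ℕ => ∑ i : Fin n, monomial (ee n i p) 1

theorem sv_add (n : ℕ) (c d : Fin n → (ℕ × ℕ →₀ ℕ)) : sv n (c + d) = sv n c + sv n d := by
  simp [sv, Finset.sum_add_distrib]

theorem phi_monomial (n : ℕ) (m : ℕ × ℕ →₀ ℕ) :
    φmap n (monomial m 1) = MvPolynomial.map (Nat.castRingHom ℂ) (PN n (monomial m 1)) := by
  simp only [φmap, PN, aeval_monomial, map_one, one_mul, Finsupp.prod, map_prod, map_pow, map_sum,
    map_monomial, q, ee]
  refine Finset.prod_congr rfl fun p _ => ?_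
  congr 1
  refine Finset.sum_congr rfl fun i _ => ?_
  simp [X, monomial_mul]

theorem coeff_phi (n : ℕ) (m : ℕ × ℕ →₀ ℕ) (s) :
    coeff s (φmap n (monomial m 1)) = ((coeff s (PN n (monomial m 1)) : ℕ) : ℂ) := by
  rw [phi_monomial, coeff_map]; rfl

theorem supp_lemma (n : ℕ) (m : ℕ × ℕ →₀ ℕ) : ∀ s,
    coeff s (PN n (monomial m 1)) ≠ 0 → ∃ c : Fin n → (ℕ × ℕ →₀ ℕ), ∑ i, c i = m ∧ sv n c = s := by
  classical
  have hadd : ∀ m1 m2 : ℕ × ℕ →₀ ℕ,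
      (∀ s, coeff s (PN n (monomial m1 1)) ≠ 0 → ∃ c : Fin n → (ℕ × ℕ →₀ ℕ), ∑ i, c i = m1 ∧ sv n c = s) →
      (∀ s, coeff s (PN n (monomial m2 1)) ≠ 0 → ∃ c : Fin n → (ℕ × ℕ →₀ ℕ), ∑ i, c i = m2 ∧ sv n c = s) →
      (∀ s, coeff s (PN n (monomial (m1 + m2) 1)) ≠ 0 → ∃ c : Fin n → (ℕ × ℕ →₀ ℕ), ∑ i, c i = m1 + m2 ∧ sv n c = s) := by
    intro m1 m2 h1 h2 s hs
    have : (monomial (m1 + m2) 1 : MvPolynomial (ℕ × ℕ) ℕ) = monomial m1 1 * monomial m2 1 := by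
      simp [monomial_mul]
    rw [this, map_mul, coeff_mul] at hs
    obtain ⟨x, hx, hx'⟩ := Finset.exists_ne_zero_of_sum_ne_zero hs
    obtain ⟨c1, hc1, hc1'⟩ := h1 _ (left_ne_zero_of_mul hx')
    obtain ⟨c2, hc2, hc2'⟩ := h2 _ (right_ne_zero_of_mul hx')
    refine ⟨c1 + c2, ?_, ?_⟩
    · simp [Finset.sum_add_distrib, hc1, hc2]
    · rw [sv_add, hc1', hc2']; simpa using hx
  have h0 : (∀ s, coeff s (PN n (monomial 0 1)) ≠ 0 → ∃ c : Fin n → (ℕ × ℕ →₀ ℕ), ∑ i, c i = 0 ∧ sv n c = s) := by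
    intro s hs
    have h1 : (monomial 0 1 : MvPolynomial (ℕ × ℕ) ℕ) = 1 := rfl
    rw [h1, map_one, coeff_one] at hs
    have : s = 0 := by by_contra h; exact hs (if_neg (Ne.symm h))
    exact ⟨0, by simp, by simp [sv, this]⟩
  induction m using Finsupp.induction_linear with
  | zero => exact h0
  | add f g hf hg => exact hadd f g hf hg
  | single p k =>
    induction k with
    | zero => simpa using h0
    | succ k ih =>
      rw [Finsupp.single_add]
      refine hadd _ _ ih ?_
      intro s hs
      have h1 : PN n (monomial (Finsupp.single p 1) 1) = ∑ i : Fin n, monomial (ee n i p) 1 := by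
        rw [PN, aeval_monomial]; simp
      rw [h1, coeff_sum] at hs
      obtain ⟨i, _, hi⟩ := Finset.exists_ne_zero_of_sum_ne_zero hs
      rw [coeff_monomial] at hi
      have hi' : ee n i p = s := by by_contra h; exact hi (if_neg h)
      refine ⟨Pi.single i (Finsupp.single p 1), by simp, ?_⟩
      rw [sv, Finset.sum_eq_single i]
      · simp [Finsupp.weight_single, hi']
      · intro j _ hj; simp [hj]
      · simp

/-- coloring a monomial -/
def cf (n : ℕ) (col : ℕ × ℕ → Fin n) (m : ℕ × ℕ →₀ ℕ) : Fin n → (ℕ × ℕ →₀ ℕ) :=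
  fun i => m.filter (fun p => col p = i)

theorem nonvan (n : ℕ) (col : ℕ × ℕ → Fin n) (m : ℕ × ℕ →₀ ℕ) :
    coeff (sv n (cf n col m)) (PN n (monomial m 1)) ≠ 0 := by
  classical
  have hadd : ∀ m1 m2 : ℕ × ℕ →₀ ℕ, coeff (sv n (cf n col m1)) (PN n (monomial m1 1)) ≠ 0 →
      coeff (sv n (cf n col m2)) (PN n (monomial m2 1)) ≠ 0 →
      coeff (sv n (cf n col (m1 + m2))) (PN n (monomial (m1 + m2) 1)) ≠ 0 := by
    intro m1 m2 h1 h2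
    have h : (monomial (m1 + m2) 1 : MvPolynomial (ℕ × ℕ) ℕ) = monomial m1 1 * monomial m2 1 := by
      simp [monomial_mul]
    have h' : cf n col (m1 + m2) = cf n col m1 + cf n col m2 := by
      funext i; simp [cf, Finsupp.filter_add]
    rw [h, h', map_mul, coeff_mul, sv_add]
    intro hz
    rw [Finset.sum_eq_zero_iff] at hz
    have := hz (sv n (cf n col m1), sv n (cf n col m2)) (by simp)
    exact mul_ne_zero h1 h2 this
  have h0 : coeff (sv n (cf n col 0)) (PN n (monomial 0 1)) ≠ 0 := by
    have h1 : (monomial 0 1 : MvPolynomial (ℕ × ℕ) ℕ) = 1 := rfl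
    have h2 : sv n (cf n col 0) = 0 := by
      have : cf n col 0 = 0 := by funext i; exact Finsupp.filter_zero _
      simp [sv, this]
    rw [h1, map_one, h2]
    simp
  induction m using Finsupp.induction_linear with
  | zero => exact h0
  | add f g hf hg => exact hadd f g hf hg
  | single p k =>
    induction k with
    | zero => simpa using h0
    | succ k ih =>
      rw [Finsupp.single_add]
      refine hadd _ _ ih ?_
      have h1 : PN n (monomial (Finsupp.single p 1) 1) = ∑ i : Fin n, monomial (ee n i p) 1 := by
        rw [PN, aeval_monomial]; simp
      have h2 : sv n (cf n col (Finsupp.single p 1)) = ee n (col p) p := by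
        rw [sv, Finset.sum_eq_single (col p)]
        · simp [cf, Finsupp.weight_single]
        · intro j _ hj; simp [cf, Finsupp.filter_single_of_neg, Ne.symm hj]
        · simp
      rw [h1, h2, coeff_sum]
      intro hz
      rw [Finset.sum_eq_zero_iff] at hz
      have := hz (col p) (by simp)
      simp at this

theorem sv_inl (n : ℕ) (c : Fin n → (ℕ × ℕ →₀ ℕ)) (i : Fin n) (a : ℕ) :
    sv n c (Sum.inl (i, a)) = (c i).mapDomain Prod.fst a := by
  classical
  have key : ∀ (j : Fin n) (A : ℕ × ℕ →₀ ℕ), Finsupp.weight (ee n j) A (Sum.inl (i, a)) =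
      if j = i then A.mapDomain Prod.fst a else 0 := by
    intro j A
    induction A using Finsupp.induction_linear with
    | zero => simp
    | add f g hf hg => simp only [map_add, Finsupp.add_apply, hf, hg, Finsupp.mapDomain_add]; split_ifs <;> simp
    | single p k =>
      rw [Finsupp.weight_single]
      simp [ee, Finsupp.single_apply]
      split_ifs <;> simp_all
  simp [sv, Finsupp.finsetSum_apply, key]

theorem sv_inr (n : ℕ) (c : Fin n → (ℕ × ℕ →₀ ℕ)) (i : Fin n) (a : ℕ) :
    sv n c (Sum.inr (i, a)) = (c i).mapDomain Prod.snd a := by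
  classical
  have key : ∀ (j : Fin n) (A : ℕ × ℕ →₀ ℕ), Finsupp.weight (ee n j) A (Sum.inr (i, a)) =
      if j = i then A.mapDomain Prod.snd a else 0 := by
    intro j A
    induction A using Finsupp.induction_linear with
    | zero => simp
    | add f g hf hg => simp only [map_add, Finsupp.add_apply, hf, hg, Finsupp.mapDomain_add]; split_ifs <;> simp
    | single p k =>
      rw [Finsupp.weight_single]
      simp [ee, Finsupp.single_apply]
      split_ifs <;> simp_all
  simp [sv, Finsupp.finsetSum_apply, key]

/-- good monomials -/
def Good (n : ℕ) : Set (ℕ × ℕ →₀ ℕ) := {m | ¬ ∃ a b : Fin (n + 1) → ℕ,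
  StrictMono a ∧ StrictAnti b ∧ ∀ i, (a i, b i) ∈ m.support}

theorem good_sep (n : ℕ) (hn : 1 ≤ n) (m : ℕ × ℕ →₀ ℕ) (hm : m ∈ Good n) :
    ∃ s, coeff s (PN n (monomial m 1)) ≠ 0 ∧
      ∀ m', coeff s (PN n (monomial m' 1)) ≠ 0 → m' = m ∨ fw m < fw m' := by
  classical
  rcases mirsky n m.support with ⟨col0, h1, h2⟩ | h
  swap
  · exact absurd h hm
  let col : ℕ × ℕ → Fin n := fun p => if h : col0 p < n then ⟨col0 p, h⟩ else ⟨0, hn⟩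
  have hcol : ∀ p ∈ m.support, (col p : ℕ) = col0 p := by
    intro p hp
    simp [col, h1 p hp]
  refine ⟨sv n (cf n col m), nonvan n col m, ?_⟩
  intro m' hm'
  obtain ⟨c, hc, hs⟩ := supp_lemma n m' _ hm'
  have hall : ∀ i, c i = cf n col m i ∨ fw (cf n col m i) < fw (c i) := by
    intro i
    refine chain_lemma _ _ _ rfl ?_ ?_ ?_
    · ext a; rw [← sv_inl, ← sv_inl, hs]
    · ext a; rw [← sv_inr, ← sv_inr, hs]
    · intro p r hp hr
      simp only [cf, Finsupp.filter_apply, ne_eq, ite_eq_right_iff, Classical.not_imp] at hp hr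
      have hp' : p ∈ m.support := by simpa using hp.2
      have hr' : r ∈ m.support := by simpa using hr.2
      apply h2 p hp' r hr'
      rw [← hcol p hp', ← hcol r hr', hp.1, hr.1]
  have hsum : ∑ i, cf n col m i = m := by
    ext p
    simp [cf, Finsupp.finsetSum_apply, Finsupp.filter_apply]
  by_cases hh : ∀ i, c i = cf n col m i
  · left
    rw [← hc, ← hsum]
    exact Finset.sum_congr rfl fun i _ => hh i
  · right
    push Not at hh
    obtain ⟨i, hi⟩ := hh
    rw [← hc, ← hsum, fw_sum, fw_sum]
    refine Finset.sum_lt_sum (fun j _ => ?_) ⟨i, Finset.mem_univ _, (hall i).resolve_left hi⟩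
    rcases hall j with h | h
    · rw [h]
    · exact h.le

theorem good_inj (n : ℕ) (hn : 1 ≤ n) (y : RR) (hy : (y.support : Set (ℕ × ℕ →₀ ℕ)) ⊆ Good n)
    (h0 : φmap n y = 0) : y = 0 := by
  classical
  by_contra hne
  obtain ⟨m, hm, hmax⟩ := y.support.exists_max_image fw (by
    rw [Finset.nonempty_iff_ne_empty]; simpa using hne)
  obtain ⟨s, hs, hs'⟩ := good_sep n hn m (hy hm)
  have e : coeff s (φmap n y) = ∑ m' ∈ y.support,
      coeff m' y * ((coeff s (PN n (monomial m' 1)) : ℕ) : ℂ) := by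
    conv_lhs => rw [y.as_sum]
    rw [map_sum, coeff_sum]
    refine Finset.sum_congr rfl fun m' _ => ?_
    have : (monomial m' (coeff m' y) : RR) = coeff m' y • monomial m' 1 := by
      simp [smul_monomial]
    rw [this, map_smul, coeff_smul, coeff_phi, smul_eq_mul]
  rw [h0, coeff_zero, Finset.sum_eq_single m] at e
  · rcases mul_eq_zero.1 e.symm with h | h
    · exact (mem_support_iff.1 hm) h
    · exact hs (by exact_mod_cast h)
  · intro m' hm' hne'
    have : coeff s (PN n (monomial m' 1)) = 0 := by
      by_contra hc
      rcases hs' m' hc with h | h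
      · exact hne' h
      · exact absurd (hmax m' hm') (by omega)
    simp [this]
  · intro h; exact absurd hm h

theorem dDet_ker (n : ℕ) (I J : Fin (n + 1) → ℕ) : φmap n (dDet n I J) = 0 := by
  classical
  rw [dDet, AlgHom.map_det]
  have : (φmap n).mapMatrix (Matrix.of fun r s => (X (I r, J s) : RR)) =
      (Matrix.of fun (r : Fin (n + 1)) (k : Fin (n + 1)) =>
        (Fin.cons 0 (fun i : Fin n => (X (Sum.inl (i, I r)) : SS n)) : Fin (n + 1) → SS n) k) *
      (Matrix.of fun (k : Fin (n + 1)) (s : Fin (n + 1)) =>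
        (Fin.cons 0 (fun i : Fin n => (X (Sum.inr (i, J s)) : SS n)) : Fin (n + 1) → SS n) k) := by
    ext1 r s
    simp [Matrix.mul_apply, Fin.sum_univ_succ, φmap, q]
  rw [this, Matrix.det_mul, Matrix.det_eq_zero_of_column_eq_zero 0 (by simp), zero_mul]

/-- the determinantal ideal -/
def DI (n : ℕ) : Ideal RR := Ideal.span {p : RR | ∃ I J : Fin (n + 1) → ℕ,
        StrictMono I ∧ StrictMono J ∧ p = dDet n I J}

theorem split_many {σ ι : Type*} (s : Finset ι) (g : ι → σ) (hg : Function.Injective g)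
    (m : σ →₀ ℕ) (h : ∀ i ∈ s, m (g i) ≠ 0) :
    ∃ d, m = d + ∑ i ∈ s, Finsupp.single (g i) 1 := by
  classical
  refine ⟨m - ∑ i ∈ s, Finsupp.single (g i) 1, (tsub_add_cancel_of_le ?_).symm⟩
  intro p
  rw [Finsupp.finsetSum_apply]
  simp only [Finsupp.single_apply]
  by_cases hp : ∃ i ∈ s, g i = p
  · obtain ⟨i, hi, rfl⟩ := hp
    rw [Finset.sum_eq_single i]
    · simpa [Nat.one_le_iff_ne_zero] using h i hi
    · intro j _ hj; exact if_neg fun e => hj (hg e)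
    · intro h; exact absurd hi h
  · rw [Finset.sum_eq_zero]
    · exact Nat.zero_le _
    · intro i hi; exact if_neg fun e => hp ⟨i, hi, e⟩

theorem straighten (n : ℕ) (N : ℕ) : ∀ m : ℕ × ℕ →₀ ℕ, fw m = N →
    (monomial m 1 : RR) ∈ (DI n).restrictScalars ℂ ⊔ restrictSupport ℂ (Good n) := by
  classical
  induction N using Nat.strong_induction_on with
  | _ N ih =>
  intro m hm
  by_cases hg : m ∈ Good n
  · apply Submodule.mem_sup_right
    rw [mem_restrictSupport_iff]
    intro x hx
    have := support_monomial_subset hx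
    simp at this
    rwa [this]
  · simp only [Good, Set.mem_ofPred_eq, not_not] at hg
    obtain ⟨a, b, ha, hb, hab⟩ := hg
    obtain ⟨d, hd⟩ := split_many Finset.univ (fun i => (a i, b i))
      (fun i j h => ha.injective (Prod.ext_iff.1 h).1) m (fun i _ => by simpa using hab i)
    -- the relation
    have hrel : (monomial d 1 : RR) * dDet n a (b ∘ Fin.rev) ∈ DI n := by
      apply Ideal.mul_mem_left
      exact Ideal.subset_span ⟨a, b ∘ Fin.rev, ha, hb.comp Fin.rev_strictAnti, rfl⟩
    have hdet : dDet n a (b ∘ Fin.rev) =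
        ((Equiv.Perm.sign (Fin.revPerm (n := n + 1)) : ℤ) : RR) *
          Matrix.det (Matrix.of fun r s => (X (a r, b s) : RR)) := by
      rw [← Matrix.det_permute']
      rfl
    have hrel2 : (monomial d 1 : RR) * Matrix.det (Matrix.of fun r s => (X (a r, b s) : RR)) ∈
        DI n := by
      rw [hdet] at hrel
      rcases Int.units_eq_one_or (Equiv.Perm.sign (Fin.revPerm (n := n + 1))) with h | h
      · simpa [h] using hrel
      · simpa [h] using hrel
    have hmon : ∀ σ : Equiv.Perm (Fin (n + 1)),
        (monomial (d + ∑ i, Finsupp.single (a (σ i), b i) 1) 1 : RR) =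
          monomial d 1 * ∏ i, X (a (σ i), b i) := by
      intro σ
      rw [← mul_one (1 : ℂ), ← monomial_mul, mul_one, monomial_sum_one]
      rfl
    rw [Matrix.det_apply', ← Finset.add_sum_erase _ _ (Finset.mem_univ 1), mul_add] at hrel2
    have hrest : (monomial d 1 : RR) * ∑ σ ∈ Finset.univ.erase (1 : Equiv.Perm (Fin (n + 1))),
        ((Equiv.Perm.sign σ : ℤ) : RR) * ∏ i, (Matrix.of fun r s => (X (a r, b s) : RR)) (σ i) i ∈
        (DI n).restrictScalars ℂ ⊔ restrictSupport ℂ (Good n) := by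
      rw [Finset.mul_sum]
      refine Submodule.sum_mem _ fun σ hσ => ?_
      have hσ1 : σ ≠ 1 := (Finset.mem_erase.1 hσ).1
      have := ih _ (by
        rw [← hm, hd, fw_add, fw_add]
        exact Nat.add_lt_add_left (rearr a b ha hb σ hσ1) _) _ (rfl :
          fw (d + ∑ i, Finsupp.single (a (σ i), b i) 1) = _)
      rw [hmon] at this
      rcases Int.units_eq_one_or (Equiv.Perm.sign σ) with h | h
      · simpa [h] using this
      · simpa [h] using this
    have hm1 : (monomial m 1 : RR) = monomial d 1 * (((Equiv.Perm.sign (1 : Equiv.Perm (Fin (n + 1))) : ℤ) : RR) * ∏ i, (Matrix.of fun r s => (X (a r, b s) : RR)) ((1 : Equiv.Perm (Fin (n + 1))) i) i) := by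
      have := hmon 1
      simp only [Equiv.Perm.one_apply] at this
      rw [hd, this]
      simp
    rw [← hm1] at hrel2
    have hrel3 := Submodule.mem_sup_left (T := restrictSupport ℂ (Good n))
      (show _ ∈ (DI n).restrictScalars ℂ from hrel2)
    exact (Submodule.add_mem_iff_left _ hrest).1 hrel3

/-- The kernel of `φ` is the ideal of `R` generated by the determinants `d_{I,J}` over all
strictly increasing tuples `I, J ∈ ℕ^{n+1}`. -/
theorem ker_phi_eq_span_det (n : ℕ) (hn : 1 ≤ n) :
    RingHom.ker (φmap n).toRingHom =
      Ideal.span {p : RR | ∃ I J : Fin (n + 1) → ℕ,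
        StrictMono I ∧ StrictMono J ∧ p = dDet n I J} := by
  change _ = DI n
  have hle : DI n ≤ RingHom.ker (φmap n).toRingHom := by
    refine Ideal.span_le.2 ?_
    rintro _ ⟨I, J, _, _, rfl⟩
    exact dDet_ker n I J
  refine le_antisymm ?_ hle
  intro p hp
  have hp0 : φmap n p = 0 := hp
  have hW : p ∈ (DI n).restrictScalars ℂ ⊔ restrictSupport ℂ (Good n) := by
    rw [p.as_sum]
    refine Submodule.sum_mem _ fun m _ => ?_
    have : (monomial m (coeff m p) : RR) = coeff m p • monomial m 1 := by
      simp [smul_monomial]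
    rw [this]
    exact Submodule.smul_mem _ _ (straighten n _ m rfl)
  obtain ⟨x, hx, y, hy, rfl⟩ := Submodule.mem_sup.1 hW
  have hx' : x ∈ DI n := hx
  have hx0 : φmap n x = 0 := hle hx'
  have hy0 : y = 0 := by
    refine good_inj n hn y ((mem_restrictSupport_iff ℂ).1 hy) ?_
    rwa [map_add, hx0, zero_add] at hp0
  rw [hy0, add_zero]
  exact hx'
end
end

section
/- For all a,b ∈ ℕ, all w ∈ ℤ, all n ≥ 1, and all tuples I = (i_0,…,i_n), J = (j_0,…,j_n) ∈ ℕ^{n+1}, one has p_{a,b,w}(d_{I,J}) = Σ_{r : i_r+w ≥ 0} λ(a,b,w,i_r)·d_{I^r,J} + Σ_{s : j_s+w ≥ 0} μ(a,b,w,j_s)·d_{I,J^s}, where I^r is the tuple obtained from I by replacing its r-th entry i_r by i_r+w, and J^s is obtained from J by replacing its s-th entry j_s by j_s+w. -/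
open MvPolynomial

noncomputable section

/-- The coefficient `λ(a,b,w,l) = (−1)^{b+1}·(b+l)!/(l+w−a)!` if `l+w−a ≥ 0`, else `0`. -/
def lamC (a b : ℕ) (w : ℤ) (l : ℕ) : ℂ :=
  if 0 ≤ (l : ℤ) + w - a then
    (-1) ^ (b + 1) * (Nat.factorial (b + l) : ℂ) /
      (Nat.factorial ((l : ℤ) + w - a).toNat : ℂ)
  else 0

/-- The coefficient `μ(a,b,w,m) = (−1)^a·(a+m)!/(m+w−b)!` if `m+w−b ≥ 0`, else `0`. -/
def muC (a b : ℕ) (w : ℤ) (m : ℕ) : ℂ :=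
  if 0 ≤ (m : ℤ) + w - b then
    (-1) ^ a * (Nat.factorial (a + m) : ℂ) /
      (Nat.factorial ((m : ℤ) + w - b).toNat : ℂ)
  else 0

/-- The derivation `p_{a,b,w}` of `R` with
`p_{a,b,w}(Q_{l,m}) = λ(a,b,w,l)·Q_{l+w,m} + μ(a,b,w,m)·Q_{l,m+w}`, where a summand is
interpreted as `0` whenever its coefficient is `0` (a nonzero coefficient forces the
corresponding shifted index to be a nonnegative integer). -/
def pDer (a b : ℕ) (w : ℤ) : Derivation ℂ RR RR :=
  MvPolynomial.mkDerivation ℂ fun lm : ℕ × ℕ =>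
    lamC a b w lm.1 • X (((lm.1 : ℤ) + w).toNat, lm.2) +
      muC a b w lm.2 • X (lm.1, ((lm.2 : ℤ) + w).toNat)

theorem der_prod_aux {ι : Type} [DecidableEq ι] (D : Derivation ℂ RR RR) (s : Finset ι) (f : ι → RR) :
    D (∏ i ∈ s, f i) = ∑ i ∈ s, (∏ j ∈ s.erase i, f j) * D (f i) := by
  induction s using Finset.induction_on with
  | empty => simp
  | insert x s hx ih =>
    rw [Finset.prod_insert hx, Derivation.leibniz, ih, Finset.sum_insert hx,
      Finset.erase_insert hx, smul_eq_mul, smul_eq_mul, Finset.mul_sum, add_comm]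
    congr 1
    refine Finset.sum_congr rfl fun i hi => ?_
    have hne : x ≠ i := fun h => hx (h ▸ hi)
    rw [Finset.erase_insert_of_ne hne, Finset.prod_insert (fun h => hx (Finset.mem_of_mem_erase h)),
      mul_assoc]

theorem lamC_zero_aux (a b : ℕ) (w : ℤ) (l : ℕ) (h : ¬ 0 ≤ (l : ℤ) + w) : lamC a b w l = 0 := by
  unfold lamC
  rw [if_neg (by omega)]

theorem muC_zero_aux (a b : ℕ) (w : ℤ) (l : ℕ) (h : ¬ 0 ≤ (l : ℤ) + w) : muC a b w l = 0 := by
  unfold muC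
  rw [if_neg (by omega)]

/-- `p_{a,b,w}(d_{I,J}) = Σ_{r : i_r+w ≥ 0} λ(a,b,w,i_r)·d_{I^r,J}
  + Σ_{s : j_s+w ≥ 0} μ(a,b,w,j_s)·d_{I,J^s}`, where `I^r` replaces the `r`-th entry of `I`
  by `i_r + w` and `J^s` replaces the `s`-th entry of `J` by `j_s + w`. -/
theorem pDer_dDet (a b : ℕ) (w : ℤ) (n : ℕ) (hn : 1 ≤ n) (I J : Fin (n + 1) → ℕ) :
    pDer a b w (dDet n I J) =
      (∑ r ∈ Finset.univ.filter (fun r : Fin (n + 1) => 0 ≤ (I r : ℤ) + w),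
        lamC a b w (I r) • dDet n (Function.update I r ((I r : ℤ) + w).toNat) J) +
      ∑ s ∈ Finset.univ.filter (fun s : Fin (n + 1) => 0 ≤ (J s : ℤ) + w),
        muC a b w (J s) • dDet n I (Function.update J s ((J s : ℤ) + w).toNat) := by
  rw [Finset.sum_filter_of_ne (fun r _ h => by
      by_contra h'
      exact h (by rw [lamC_zero_aux _ _ _ _ h', zero_smul])),
    Finset.sum_filter_of_ne (fun r _ h => by
      by_contra h'
      exact h (by rw [muC_zero_aux _ _ _ _ h', zero_smul]))]
  unfold dDet
  simp only [Matrix.det_apply, Matrix.of_apply, Finset.smul_sum]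
  rw [Finset.sum_comm, Finset.sum_comm (s := Finset.univ (α := Fin (n + 1))),
    ← Finset.sum_add_distrib, map_sum]
  refine Finset.sum_congr rfl fun σ _ => ?_
  rw [← Equiv.sum_comp σ, ← Finset.sum_add_distrib, Units.smul_def, map_zsmul, der_prod_aux,
    Finset.smul_sum]
  refine Finset.sum_congr rfl fun i _ => ?_
  have h1 : ∏ j, (X (Function.update I (σ i) ((I (σ i) : ℤ) + w).toNat (σ j), J j) : RR) =
      (∏ j ∈ Finset.univ.erase i, X (I (σ j), J j)) * X (((I (σ i) : ℤ) + w).toNat, J i) := by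
    rw [← Finset.prod_erase_mul _ _ (Finset.mem_univ i)]
    congr 1
    · refine Finset.prod_congr rfl fun j hj => ?_
      rw [Function.update_of_ne (fun h => Finset.ne_of_mem_erase hj (σ.injective h))]
    · rw [Function.update_self]
  have h2 : ∏ j, (X (I (σ j), Function.update J i ((J i : ℤ) + w).toNat j) : RR) =
      (∏ j ∈ Finset.univ.erase i, X (I (σ j), J j)) * X (I (σ i), ((J i : ℤ) + w).toNat) := by
    rw [← Finset.prod_erase_mul _ _ (Finset.mem_univ i)]
    congr 1
    · refine Finset.prod_congr rfl fun j hj => ?_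
      rw [Function.update_of_ne (Finset.ne_of_mem_erase hj)]
    · rw [Function.update_self]
  rw [h1, h2]
  simp only [pDer, mkDerivation_X, Units.smul_def]
  rw [mul_add, smul_add, mul_smul_comm, mul_smul_comm, smul_comm (lamC a b w (I (σ i))),
    smul_comm (muC a b w (J i))]
end
end

section
/- For every n ≥ 1, the subspace U_n ⊆ R is invariant under the derivation p_{a,b,w} for all a,b ∈ ℕ and all w ∈ ℤ. -/
open MvPolynomial

noncomputable section

/-- The span `U_n ⊆ R` of the determinants `d_{I,J}` over strictly increasing `I, J`. -/
def Un (n : ℕ) : Submodule ℂ RR :=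
  Submodule.span ℂ
    {p : RR | ∃ I J : Fin (n + 1) → ℕ, StrictMono I ∧ StrictMono J ∧ p = dDet n I J}

theorem aux_der_prod {ι : Type*} [DecidableEq ι] (D : Derivation ℂ RR RR) (f : ι → RR)
    (s : Finset ι) :
    D (∏ i ∈ s, f i) = ∑ i ∈ s, D (f i) * ∏ j ∈ s.erase i, f j := by
  induction s using Finset.induction_on with
  | empty => simp
  | insert a s ha ih =>
    rw [Finset.prod_insert ha, Derivation.leibniz, ih, Finset.sum_insert ha,
      Finset.erase_insert ha, smul_eq_mul, smul_eq_mul, Finset.mul_sum, add_comm]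
    congr 1
    · ring
    · apply Finset.sum_congr rfl
      intro i hi
      have hne : a ≠ i := by rintro rfl; exact ha hi
      rw [Finset.erase_insert_of_ne hne, Finset.prod_insert (by simp [ha])]
      ring

theorem aux_der_det {n : ℕ} (D : Derivation ℂ RR RR) (M : Matrix (Fin n) (Fin n) RR) :
    D M.det = ∑ i, (M.updateCol i (fun r => D (M r i))).det := by
  simp only [Matrix.det_apply, map_sum]
  rw [Finset.sum_comm]
  apply Finset.sum_congr rfl
  intro σ _
  rw [← Finset.smul_sum, Units.smul_def, Units.smul_def, map_zsmul, aux_der_prod]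
  congr 1
  apply Finset.sum_congr rfl
  intro i _
  rw [← Finset.mul_prod_erase Finset.univ _ (Finset.mem_univ i)]
  congr 1
  · simp
  · apply Finset.prod_congr rfl
    intro j hj
    rw [Matrix.updateCol_ne (Finset.ne_of_mem_erase hj)]

theorem aux_units_mem (n : ℕ) (u : ℤˣ) (x : RR) (h : ((u : ℤ) : RR) * x ∈ Un n) : x ∈ Un n := by
  rcases Int.units_eq_one_or u with rfl | rfl
  · simpa using h
  · simpa using h

theorem aux_sort {n : ℕ} (I : Fin (n + 1) → ℕ) (hI : Function.Injective I) :
    StrictMono (I ∘ Tuple.sort I) :=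
  (Tuple.monotone_sort I).strictMono_of_injective (hI.comp (Equiv.injective _))

theorem aux_dDet_mem (n : ℕ) (I J : Fin (n + 1) → ℕ) : dDet n I J ∈ Un n := by
  by_cases hI : Function.Injective I
  · by_cases hJ : Function.Injective J
    · apply aux_units_mem n (Equiv.Perm.sign (Tuple.sort I))
      apply aux_units_mem n (Equiv.Perm.sign (Tuple.sort J))
      unfold dDet
      rw [← Matrix.det_permute, ← Matrix.det_permute']
      exact Submodule.subset_span ⟨_, _, aux_sort I hI, aux_sort J hJ, rfl⟩
    · simp only [Function.Injective, not_forall] at hJ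
      obtain ⟨x, y, hxy, hne⟩ := hJ
      have : dDet n I J = 0 := Matrix.det_zero_of_column_eq hne (by intro k; simp [hxy])
      rw [this]; exact zero_mem _
  · simp only [Function.Injective, not_forall] at hI
    obtain ⟨x, y, hxy, hne⟩ := hI
    have : dDet n I J = 0 := Matrix.det_zero_of_row_eq hne (by ext k; simp [hxy])
    rw [this]; exact zero_mem _

theorem aux_det_col (n : ℕ) (f : ℕ → ℂ) (s : ℕ → ℕ) (D : Derivation ℂ RR RR)
    (g : ℕ → ℕ → RR) (hD : ∀ l m, D (g l m) = f m • g l (s m)) (I J : Fin (n + 1) → ℕ) :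
    D (Matrix.det (Matrix.of fun r c => g (I r) (J c))) =
      ∑ i, f (J i) •
        Matrix.det (Matrix.of fun r c => g (I r) (Function.update J i (s (J i)) c)) := by
  rw [aux_der_det]
  refine Finset.sum_congr rfl fun i _ => ?_
  have h1 : (fun r => D ((Matrix.of fun r c => g (I r) (J c)) r i))
      = (C (f (J i)) : RR) • fun r => g (I r) (s (J i)) := by
    funext r
    simp [hD, MvPolynomial.smul_eq_C_mul]
  rw [h1, Matrix.det_updateCol_smul, MvPolynomial.smul_eq_C_mul]
  congr 2
  ext1 r c
  by_cases hc : c = i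
  · subst hc; simp
  · simp [Matrix.updateCol_ne hc, Function.update_of_ne hc]

theorem aux_col (n : ℕ) (f : ℕ → ℂ) (s : ℕ → ℕ) (D : Derivation ℂ RR RR)
    (hD : ∀ l m, D (X (l, m)) = f m • X (l, s m)) (I J : Fin (n + 1) → ℕ) :
    D (dDet n I J) ∈ Un n := by
  unfold dDet
  rw [aux_det_col n f s D (fun l m => X (l, m)) hD]
  exact Submodule.sum_mem _ fun i _ => Submodule.smul_mem _ _ (aux_dDet_mem n _ _)

theorem aux_row (n : ℕ) (f : ℕ → ℂ) (s : ℕ → ℕ) (D : Derivation ℂ RR RR)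
    (hD : ∀ l m, D (X (l, m)) = f l • X (s l, m)) (I J : Fin (n + 1) → ℕ) :
    D (dDet n I J) ∈ Un n := by
  have ht : ∀ I J : Fin (n + 1) → ℕ,
      dDet n I J = Matrix.det (Matrix.of fun r c => (X (I c, J r) : RR)) :=
    fun I J => (Matrix.det_transpose _).symm
  rw [ht, aux_det_col n f s D (fun l m => X (m, l)) (fun l m => hD m l)]
  refine Submodule.sum_mem _ fun i _ => Submodule.smul_mem _ _ ?_
  rw [← ht]
  exact aux_dDet_mem n _ _

theorem pDer_mem_Un (n : ℕ) (hn : 1 ≤ n) (a b : ℕ) (w : ℤ) :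
    ∀ x ∈ Un n, pDer a b w x ∈ Un n := by
  intro x hx
  induction hx using Submodule.span_induction with
  | mem x h =>
    obtain ⟨I, J, -, -, rfl⟩ := h
    have : pDer a b w =
        mkDerivation ℂ (fun lm : ℕ × ℕ => lamC a b w lm.1 • (X (((lm.1 : ℤ) + w).toNat, lm.2) : RR))
        + mkDerivation ℂ
          (fun lm : ℕ × ℕ => muC a b w lm.2 • (X (lm.1, ((lm.2 : ℤ) + w).toNat) : RR)) := by
      apply MvPolynomial.derivation_ext
      intro i
      simp [pDer, mkDerivation_X]
    rw [this, Derivation.add_apply]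
    refine add_mem (aux_row n (lamC a b w) (fun l => ((l : ℤ) + w).toNat) _ ?_ I J)
      (aux_col n (muC a b w) (fun l => ((l : ℤ) + w).toNat) _ ?_ I J)
    · intro l m; rw [mkDerivation_X]
    · intro l m; rw [mkDerivation_X]
  | zero => simp
  | add x y _ _ hx hy => rw [map_add]; exact add_mem hx hy
  | smul c x _ hx => rw [Derivation.map_smul]; exact Submodule.smul_mem _ _ hx
end
end

section
/- For every n ≥ 1, every a,b ∈ ℕ, and every integer w < 0, one has p_{a,b,w}(d_0) = 0. (This is the associated-graded form of the statement that D_0 is a singular vector of the vacuum module M_{−n}.) -/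
open MvPolynomial

noncomputable section

/-- The tuple `ι = (0,1,…,n)`. -/
def iot (n : ℕ) : Fin (n + 1) → ℕ := fun r => (r : ℕ)

theorem der_prod {ι : Type*} [DecidableEq ι] (D : Derivation ℂ RR RR) (s : Finset ι) (f : ι → RR) :
    D (∏ i ∈ s, f i) = ∑ i ∈ s, (∏ j ∈ s.erase i, f j) * D (f i) := by
  induction s using Finset.induction_on with
  | empty => simp
  | insert x s hx ih =>
    rw [Finset.prod_insert hx, Derivation.leibniz, ih, Finset.sum_insert hx,
      Finset.erase_insert hx, smul_eq_mul, smul_eq_mul, Finset.mul_sum, add_comm]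
    congr 1
    refine Finset.sum_congr rfl fun i hi => ?_
    have hne : x ≠ i := fun h => hx (h ▸ hi)
    rw [Finset.erase_insert_of_ne hne, Finset.prod_insert (by simp [hx]), mul_assoc]

theorem der_det {ι : Type*} [DecidableEq ι] [Fintype ι] (D : Derivation ℂ RR RR)
    (M : Matrix ι ι RR) :
    D M.det = (M.adjugate * Matrix.of (fun r s => D (M r s))).trace := by
  have key : ∀ i, (M.adjugate * Matrix.of (fun r s => D (M r s))) i i
      = (M.updateCol i (fun r => D (M r i))).det := by
    intro i
    rw [← Matrix.cramer_apply, Matrix.cramer_eq_adjugate_mulVec]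
    rfl
  simp only [Matrix.trace, Matrix.diag_apply, key]
  simp only [Matrix.det_apply]
  rw [map_sum, Finset.sum_comm]
  refine Finset.sum_congr rfl fun σ _ => ?_
  have h : ∀ x : RR, D (Equiv.Perm.sign σ • x) = Equiv.Perm.sign σ • D x := by
    intro x
    rw [Units.smul_def, Units.smul_def, map_zsmul]
  rw [h, der_prod, Finset.smul_sum]
  refine Finset.sum_congr rfl fun i _ => ?_
  congr 1
  rw [← Finset.prod_erase_mul _ _ (Finset.mem_univ i)]
  congr 1
  · refine Finset.prod_congr rfl fun j hj => ?_
    rw [Matrix.updateCol_ne (Finset.ne_of_mem_erase hj)]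
  · simp

/-- For every `n ≥ 1`, `a, b ∈ ℕ` and `w < 0`, one has `p_{a,b,w}(d_0) = 0`, where
`d_0 = d_{ι,ι}` and `ι = (0,1,…,n)`. (Associated-graded form of the statement that `D_0`
is a singular vector of the vacuum module `M_{−n}`.) -/
theorem pDer_d0_eq_zero (n : ℕ) (hn : 1 ≤ n) (a b : ℕ) (w : ℤ) (hw : w < 0) :
    pDer a b w (dDet n (iot n) (iot n)) = 0 := by
  set M : Matrix (Fin (n+1)) (Fin (n+1)) RR :=
    Matrix.of fun r s => (X (iot n r, iot n s) : RR) with hM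
  let A : Matrix (Fin (n+1)) (Fin (n+1)) RR :=
    Matrix.of fun r k => if ((r : ℤ) + w).toNat = (k : ℕ) then C (lamC a b w r) else 0
  let B : Matrix (Fin (n+1)) (Fin (n+1)) RR :=
    Matrix.of fun k s => if ((s : ℤ) + w).toNat = (k : ℕ) then C (muC a b w s) else 0
  have hlt : ∀ r : Fin (n+1), (((r : ℕ) : ℤ) + w).toNat < n + 1 := by
    intro r; have := r.2; omega
  have hD : Matrix.of (fun r s => pDer a b w (M r s)) = A * M + M * B := by
    ext1 r s
    have h1 : ∀ k : Fin (n+1), (((r : ℤ) + w).toNat = (k : ℕ)) ↔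
        (⟨_, hlt r⟩ : Fin (n+1)) = k := fun k => by rw [Fin.ext_iff]
    have h2 : ∀ k : Fin (n+1), (((s : ℤ) + w).toNat = (k : ℕ)) ↔
        (⟨_, hlt s⟩ : Fin (n+1)) = k := fun k => by rw [Fin.ext_iff]
    simp [Matrix.mul_apply, A, B, hM, pDer, mkDerivation_X, iot, h1, h2, ite_mul, mul_ite,
      MvPolynomial.smul_eq_C_mul, mul_comm]
  have hA : A.trace = 0 := by
    refine Finset.sum_eq_zero fun r _ => ?_
    simp only [A, Matrix.diag_apply, Matrix.of_apply]
    split_ifs with h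
    · rw [lamC, if_neg (by omega), map_zero]
    · rfl
  have hB : B.trace = 0 := by
    refine Finset.sum_eq_zero fun r _ => ?_
    simp only [B, Matrix.diag_apply, Matrix.of_apply]
    split_ifs with h
    · rw [muC, if_neg (by omega), map_zero]
    · rfl
  change pDer a b w M.det = 0
  rw [der_det, hD, mul_add, Matrix.trace_add, ← mul_assoc M.adjugate M B,
    Matrix.adjugate_mul, Matrix.trace_mul_comm, mul_assoc, Matrix.mul_adjugate]
  simp [hA, hB]
end
end

section
/- For every n ≥ 1 and every integer a ≥ n+2, p_{a,0,1}(d_0) = (−1)^{a}·((a+n)!/(n+1)!)·d_{ι,ι'}, where ι' = (0,1,…,n−1,n+1). -/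
open MvPolynomial

noncomputable section

theorem aux_prod {ι : Type} [DecidableEq ι] (D : Derivation ℂ RR RR) (s : Finset ι) (f : ι → RR) :
    D (∏ i ∈ s, f i) = ∑ j ∈ s, ∏ i ∈ s, if i = j then D (f i) else f i := by
  induction s using Finset.induction_on with
  | empty => simp
  | insert x s hx ih =>
    rw [Finset.prod_insert hx, D.leibniz, ih, Finset.sum_insert hx, Finset.prod_insert hx]
    simp only [if_true, smul_eq_mul]
    have h1 : ∏ i ∈ s, (if i = x then D (f i) else f i) = ∏ i ∈ s, f i :=
      Finset.prod_congr rfl fun i hi => if_neg (by rintro rfl; exact hx hi)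
    have h2 : ∑ j ∈ s, ∏ i ∈ insert x s, (if i = j then D (f i) else f i) =
        ∑ j ∈ s, f x * ∏ i ∈ s, (if i = j then D (f i) else f i) := by
      refine Finset.sum_congr rfl fun j hj => ?_
      rw [Finset.prod_insert hx, if_neg (by rintro rfl; exact hx hj)]
    rw [h1, h2, ← Finset.mul_sum]
    ring

theorem aux_det {n : ℕ} (D : Derivation ℂ RR RR) (M : Matrix (Fin n) (Fin n) RR) :
    D M.det = ∑ j, (M.updateCol j fun i => D (M i j)).det := by
  simp only [Matrix.det_apply, map_sum]
  rw [Finset.sum_comm]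
  refine Finset.sum_congr rfl fun σ _ => ?_
  rw [← Finset.smul_sum, Units.smul_def, Units.smul_def, map_zsmul, aux_prod]
  congr 1
  refine Finset.sum_congr rfl fun j _ => Finset.prod_congr rfl fun i _ => ?_
  rw [Matrix.updateCol_apply]
  split_ifs with h
  · rw [h]
  · rfl

theorem aux_entry (a l m : ℕ) (h : l + 1 < a) :
    pDer a 0 1 (X (l, m)) =
      ((-1) ^ a * (Nat.factorial (a + m) : ℂ) / (Nat.factorial (m + 1) : ℂ)) •
        (X (l, m + 1) : RR) := by
  have h1 : lamC a 0 1 l = 0 := if_neg (by omega)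
  have h2 : muC a 0 1 m = (-1) ^ a * (Nat.factorial (a + m) : ℂ) / (Nat.factorial (m + 1) : ℂ) := by
    unfold muC
    rw [if_pos (by omega)]
    congr
  rw [pDer, mkDerivation_X]
  simp only [h1, h2, zero_smul, zero_add]
  congr

/-- For `a ≥ n+2`: `p_{a,0,1}(d_0) = (−1)^a·((a+n)!/(n+1)!)·d_{ι,ι'}`, where
`ι' = (0,1,…,n−1,n+1)`. -/
theorem pDer_a_zero_one_d0 (n : ℕ) (hn : 1 ≤ n) (a : ℕ) (ha : n + 2 ≤ a) :
    pDer a 0 1 (dDet n (iot n) (iot n)) =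
      ((-1) ^ a * (Nat.factorial (a + n) : ℂ) / (Nat.factorial (n + 1) : ℂ)) •
        dDet n (iot n) (Function.update (iot n) (Fin.last n) (n + 1)) := by
  unfold dDet
  rw [aux_det, Finset.sum_eq_single (Fin.last n)]
  · have e : (fun i : Fin (n + 1) => pDer a 0 1
        ((Matrix.of fun r s => (X (iot n r, iot n s) : RR)) i (Fin.last n))) =
        (C ((-1) ^ a * (Nat.factorial (a + n) : ℂ) / (Nat.factorial (n + 1) : ℂ)) : RR) •
          fun i : Fin (n + 1) => (X ((i : ℕ), n + 1) : RR) := by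
      funext i
      simp only [Matrix.of_apply, Pi.smul_apply, iot, smul_eq_mul, Fin.val_last]
      rw [aux_entry _ _ _ (by omega), smul_eq_C_mul]
    rw [e, Matrix.det_updateCol_smul, smul_eq_C_mul]
    congr 2
    ext1 r s
    rw [Matrix.updateCol_apply, Matrix.of_apply, Matrix.of_apply, Function.update_apply]
    split_ifs <;> rfl
  · intro j _ hj
    have hlt : (j : ℕ) < n := Fin.val_lt_last hj
    have e : (fun i : Fin (n + 1) => pDer a 0 1
        ((Matrix.of fun r s => (X (iot n r, iot n s) : RR)) i j)) =
        (C ((-1) ^ a * (Nat.factorial (a + j) : ℂ) / (Nat.factorial (j + 1) : ℂ)) : RR) •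
          fun i : Fin (n + 1) => (X ((i : ℕ), (j : ℕ) + 1) : RR) := by
      funext i
      simp only [Matrix.of_apply, Pi.smul_apply, iot, smul_eq_mul]
      rw [aux_entry _ _ _ (by omega), smul_eq_C_mul]
    rw [e, Matrix.det_updateCol_smul]
    have hne : (⟨j + 1, by omega⟩ : Fin (n + 1)) ≠ j := by
      intro h
      have := congrArg Fin.val h
      simp at this
    rw [Matrix.det_zero_of_column_eq hne, mul_zero]
    intro k
    rw [Matrix.updateCol_self, Matrix.updateCol_ne hne]
    rfl
  · simp
end
end

section
/- For every m ≥ 1, the subspace A_m is the internal direct sum of ∂(A_{m−1}) and the line ℂ·Q_{m,0}; that is, A_m = ∂(A_{m−1}) ⊕ ℂ·Q_{m,0}. -/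
open MvPolynomial

noncomputable section

/-- The derivation `∂` of `R` with `∂Q_{a,b} = Q_{a+1,b} + Q_{a,b+1}`. -/
def del : Derivation ℂ RR RR :=
  MvPolynomial.mkDerivation ℂ fun ab : ℕ × ℕ =>
    (X (ab.1 + 1, ab.2) : RR) + X (ab.1, ab.2 + 1)

/-- `A_m`: the ℂ-linear span of `{Q_{a,b} : a + b = m}`. -/
def Am (m : ℕ) : Submodule ℂ RR :=
  Submodule.span ℂ {p : RR | ∃ a b : ℕ, a + b = m ∧ p = X (a, b)}

/-- For `m ≥ 1`, `A_m` is the internal direct sum `∂(A_{m−1}) ⊕ ℂ·Q_{m,0}`. -/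
theorem Am_eq_del_sup_span (m : ℕ) (hm : 1 ≤ m) :
    Am m = Submodule.map del.toLinearMap (Am (m - 1)) ⊔
        Submodule.span ℂ {(X (m, 0) : RR)} ∧
      Disjoint (Submodule.map del.toLinearMap (Am (m - 1)))
        (Submodule.span ℂ {(X (m, 0) : RR)}) := by
  obtain ⟨n, rfl⟩ : ∃ n, m = n + 1 := ⟨m - 1, by omega⟩
  rw [Nat.add_sub_cancel]
  have hd : ∀ a b : ℕ, del.toLinearMap (X (a, b) : RR) = X (a + 1, b) + X (a, b + 1) := by
    intro a b
    change del (X (a, b)) = _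
    rw [del, MvPolynomial.mkDerivation_X]
  refine ⟨le_antisymm ?_ ?_, ?_⟩
  · have key : ∀ b a : ℕ, a + b = n + 1 → (X (a, b) : RR) ∈
        Submodule.map del.toLinearMap (Am n) ⊔ Submodule.span ℂ {(X (n + 1, 0) : RR)} := by
      intro b
      induction b with
      | zero =>
        intro a h
        obtain rfl : a = n + 1 := by omega
        exact Submodule.mem_sup_right (Submodule.mem_span_singleton_self _)
      | succ b ih =>
        intro a h
        have h1 := ih (a + 1) (by omega)
        have h2 : del.toLinearMap (X (a, b) : RR) ∈
            Submodule.map del.toLinearMap (Am n) ⊔ Submodule.span ℂ {(X (n + 1, 0) : RR)} :=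
          Submodule.mem_sup_left (Submodule.mem_map_of_mem
            (Submodule.subset_span ⟨a, b, by omega, rfl⟩))
        have h3 := Submodule.sub_mem _ h2 h1
        rwa [hd, add_sub_cancel_left] at h3
    refine Submodule.span_le.2 ?_
    rintro p ⟨a, b, h, rfl⟩
    exact key b a h
  · refine sup_le ?_ ?_
    · rw [Am, Submodule.map_span_le]
      rintro p ⟨a, b, h, rfl⟩
      rw [hd]
      exact Submodule.add_mem _ (Submodule.subset_span ⟨a + 1, b, by omega, rfl⟩)
        (Submodule.subset_span ⟨a, b + 1, by omega, rfl⟩)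
    · rw [Submodule.span_singleton_le_iff_mem]
      exact Submodule.subset_span ⟨n + 1, 0, rfl, rfl⟩
  · let e : RR →ₗ[ℂ] ℂ := (aeval (fun ab : ℕ × ℕ => ((-1 : ℂ)) ^ ab.2)).toLinearMap
    have he : ∀ a b : ℕ, e (X (a, b)) = (-1) ^ b := by
      intro a b
      simp [e]
    have hk : Submodule.map del.toLinearMap (Am n) ≤ LinearMap.ker e := by
      rw [Am, Submodule.map_span_le]
      rintro p ⟨a, b, h, rfl⟩
      rw [hd, LinearMap.mem_ker, map_add, he, he, pow_succ]
      ring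
    rw [Submodule.disjoint_def]
    intro x hx hx2
    obtain ⟨c, rfl⟩ := Submodule.mem_span_singleton.1 hx2
    have h := hk hx
    rw [LinearMap.mem_ker, map_smul, he] at h
    have hc : c = 0 := by simpa using h
    rw [hc, zero_smul]
end
end

section
/- For every m ≥ 0, the family {∂^i(Q_{m−i,0}) : 0 ≤ i ≤ m} is a ℂ-basis of A_m. -/
open MvPolynomial

noncomputable section

lemma del_X (a b : ℕ) : del.toLinearMap (X (a, b) : RR) = X (a + 1, b) + X (a, b + 1) := by
  simp [del, mkDerivation_X]

lemma del_mem (m : ℕ) (p : RR) (hp : p ∈ Am m) : del.toLinearMap p ∈ Am (m + 1) := by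
  have : Am m ≤ (Am (m + 1)).comap del.toLinearMap := by
    refine Submodule.span_le.2 ?_
    rintro _ ⟨a, b, h, rfl⟩
    show del.toLinearMap (X (a, b) : RR) ∈ Am (m + 1)
    rw [del_X]
    exact add_mem (Submodule.subset_span ⟨_, _, by omega, rfl⟩)
      (Submodule.subset_span ⟨_, _, by omega, rfl⟩)
  exact this hp

lemma del_pow_mem (i m : ℕ) (p : RR) (hp : p ∈ Am m) :
    (del.toLinearMap ^ i) p ∈ Am (m + i) := by
  induction i with
  | zero => simpa using hp
  | succ k ih =>
    rw [pow_succ', Module.End.mul_apply]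
    exact del_mem _ _ ih

lemma span_eq_Am (m : ℕ) : Submodule.span ℂ (Set.range
        (fun i : Fin (m + 1) => (del.toLinearMap ^ (i : ℕ)) (X (m - (i : ℕ), 0) : RR))) =
        Am m := by
  apply le_antisymm
  · rw [Submodule.span_le]
    rintro _ ⟨i, rfl⟩
    have h := del_pow_mem i (m - i) (X (m - (i : ℕ), 0) : RR)
      (Submodule.subset_span ⟨_, _, by omega, rfl⟩)
    rwa [Nat.sub_add_cancel (by omega)] at h
  · induction m with
    | zero =>
      refine Submodule.span_le.2 ?_
      rintro _ ⟨a, b, h, rfl⟩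
      obtain rfl : a = 0 := by omega
      obtain rfl : b = 0 := by omega
      exact Submodule.subset_span ⟨0, by simp⟩
    | succ m ih =>
      have key : ∀ p ∈ Am m, del.toLinearMap p ∈ Submodule.span ℂ (Set.range
        (fun i : Fin (m + 1 + 1) =>
          (del.toLinearMap ^ (i : ℕ)) (X (m + 1 - (i : ℕ), 0) : RR))) := by
        intro p hp
        have h := ih hp
        refine (Submodule.span_le (p := (Submodule.span ℂ (Set.range
          (fun i : Fin (m + 1 + 1) =>
          (del.toLinearMap ^ (i : ℕ)) (X (m + 1 - (i : ℕ), 0) : RR)))).comap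
            del.toLinearMap)).2 ?_ h
        rintro _ ⟨i, rfl⟩
        refine Submodule.subset_span ⟨i.succ, ?_⟩
        simp only [Fin.val_succ, Nat.add_sub_add_right]
        rw [pow_succ', Module.End.mul_apply]
      refine Submodule.span_le.2 ?_
      rintro _ ⟨a, b, h, rfl⟩
      induction b generalizing a with
      | zero =>
        obtain rfl : a = m + 1 := by omega
        exact Submodule.subset_span ⟨0, by simp⟩
      | succ b ihb =>
        have h1 := key (X (a, b)) (Submodule.subset_span ⟨a, b, by omega, rfl⟩)
        have h2 := ihb (a + 1) (by omega)
        rw [del_X] at h1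
        have h3 := sub_mem h1 h2
        rwa [add_sub_cancel_left] at h3

lemma finrank_Am (m : ℕ) : Module.finrank ℂ (Am m) = m + 1 := by
  have hl : LinearIndependent ℂ (fun i : Fin (m + 1) => (X (m - (i : ℕ), (i : ℕ)) : RR)) :=
    (MvPolynomial.linearIndependent_X (ℕ × ℕ) ℂ).comp
      (fun i : Fin (m + 1) => (m - (i : ℕ), (i : ℕ)))
      (fun i j h => Fin.ext (Prod.ext_iff.1 h).2)
  have h := finrank_span_eq_card hl
  rw [Fintype.card_fin] at h
  have e : {p : RR | ∃ a b : ℕ, a + b = m ∧ p = X (a, b)} =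
      Set.range (fun i : Fin (m + 1) => (X (m - (i : ℕ), (i : ℕ)) : RR)) := by
    ext p
    constructor
    · rintro ⟨a, b, h, rfl⟩
      exact ⟨⟨b, by omega⟩, by simp [← h]⟩
    · rintro ⟨i, rfl⟩
      exact ⟨_, _, by omega, rfl⟩
  rw [← h, Am, e]

/-- For every `m ≥ 0`, the family `{∂^i(Q_{m−i,0}) : 0 ≤ i ≤ m}` is a ℂ-basis of `A_m`. -/
theorem del_pow_basis (m : ℕ) :
    LinearIndependent ℂ
        (fun i : Fin (m + 1) => (del.toLinearMap ^ (i : ℕ)) (X (m - (i : ℕ), 0) : RR)) ∧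
      Submodule.span ℂ (Set.range
        (fun i : Fin (m + 1) => (del.toLinearMap ^ (i : ℕ)) (X (m - (i : ℕ), 0) : RR))) =
        Am m := by
  refine ⟨?_, span_eq_Am m⟩
  rw [linearIndependent_iff_card_eq_finrank_span, Set.finrank, span_eq_Am, finrank_Am,
    Fintype.card_fin]
end
end

section
/- For every n ≥ 1, the family of determinants {d_{I,J} : I, J ∈ ℕ^{n+1} strictly increasing} is linearly independent over ℂ; in particular it is a basis of U_n. -/
open MvPolynomial

noncomputable section

theorem aux_monomial_key {n : ℕ} {I J I' J' : Fin (n + 1) → ℕ} (hI : StrictMono I)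
    (hJ : StrictMono J) (hI' : StrictMono I') (hJ' : StrictMono J')
    (σ : Equiv.Perm (Fin (n + 1)))
    (h : (∑ r, Finsupp.single (I' (σ r), J' r) 1 : ℕ × ℕ →₀ ℕ) =
      ∑ r, Finsupp.single (I r, J r) 1) : I' = I ∧ J' = J ∧ σ = 1 := by
  have key : ∀ (f : Fin (n + 1) → ℕ × ℕ) (x : ℕ × ℕ),
      (∑ r, Finsupp.single (f r) 1 : ℕ × ℕ →₀ ℕ) x ≠ 0 ↔ x ∈ Set.range f := by
    intro f x
    simp [Finsupp.finsetSum_apply, Finsupp.single_apply, Finset.sum_eq_zero_iff]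
  have hr : Set.range (fun r => (I' (σ r), J' r)) = Set.range (fun r => (I r, J r)) := by
    ext x
    rw [← key, ← key, h]
  have h1 : Set.range J' = Set.range J := by
    have := congrArg (Set.image Prod.snd) hr
    simpa [← Set.range_comp, Function.comp_def] using this
  have h2 : Set.range I' = Set.range I := by
    have := congrArg (Set.image Prod.fst) hr
    rw [← Set.range_comp, ← Set.range_comp] at this
    have e : (Prod.fst ∘ fun r => (I' (σ r), J' r)) = I' ∘ σ := rfl
    rw [e, EquivLike.range_comp] at this
    exact this
  have eJ := (StrictMono.range_inj hJ' hJ).1 h1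
  have eI := (StrictMono.range_inj hI' hI).1 h2
  subst eJ eI
  refine ⟨rfl, rfl, ?_⟩
  ext1 r
  have : (I' (σ r), J' r) ∈ Set.range (fun r => (I' r, J' r)) := hr ▸ ⟨r, rfl⟩
  obtain ⟨s, hs⟩ := this
  simp only [Prod.mk.injEq] at hs
  have := hJ'.injective hs.2
  subst this
  exact (hI'.injective hs.1).symm

theorem aux_coeff_dDet {n : ℕ} {I J I' J' : Fin (n + 1) → ℕ} (hI : StrictMono I)
    (hJ : StrictMono J) (hI' : StrictMono I') (hJ' : StrictMono J') :
    coeff (∑ r, Finsupp.single (I r, J r) 1) (dDet n I' J') =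
      if I' = I ∧ J' = J then 1 else 0 := by
  have hm : ∀ σ : Equiv.Perm (Fin (n + 1)), (∏ r, (X (I' (σ r), J' r) : RR)) =
      monomial (∑ r, Finsupp.single (I' (σ r), J' r) 1) 1 := by
    intro σ
    rw [monomial_sum_one]
    rfl
  have hc : ∀ σ : Equiv.Perm (Fin (n + 1)),
      coeff (∑ r, Finsupp.single (I r, J r) 1)
        (Equiv.Perm.sign σ • (∏ r, (X (I' (σ r), J' r) : RR))) =
      if σ = 1 then (if I' = I ∧ J' = J then 1 else 0) else 0 := by
    intro σ
    have hs : coeff (∑ r, Finsupp.single (I r, J r) 1)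
        (Equiv.Perm.sign σ • (∏ r, (X (I' (σ r), J' r) : RR))) = Equiv.Perm.sign σ •
        coeff (∑ r, Finsupp.single (I r, J r) 1) (∏ r, (X (I' (σ r), J' r) : RR)) := by
      rcases Int.units_eq_one_or (Equiv.Perm.sign σ) with h | h <;> simp [h]
    rw [hs, hm, coeff_monomial]
    by_cases h : (∑ r, Finsupp.single (I' (σ r), J' r) 1 : ℕ × ℕ →₀ ℕ) =
      ∑ r, Finsupp.single (I r, J r) 1
    · obtain ⟨a, b, c⟩ := aux_monomial_key hI hJ hI' hJ' σ h
      subst a b c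
      simp
    · rw [if_neg h, smul_zero]
      split_ifs with h3 h4
      · obtain ⟨a, b⟩ := h4
        subst a b h3
        exact absurd rfl h
      · rfl
      · rfl
  unfold dDet
  rw [Matrix.det_apply, coeff_sum]
  simp only [Matrix.of_apply]
  rw [Finset.sum_congr rfl (fun σ _ => hc σ)]
  simp

/-- The family `{d_{I,J} : I, J strictly increasing}` is linearly independent over ℂ;
together with the fact that it spans `U_n`, it is a basis of `U_n`. -/
theorem dDet_linearIndependent (n : ℕ) (hn : 1 ≤ n) :
    LinearIndependent ℂ
        (fun p : {IJ : (Fin (n + 1) → ℕ) × (Fin (n + 1) → ℕ) //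
            StrictMono IJ.1 ∧ StrictMono IJ.2} => dDet n p.1.1 p.1.2) ∧
      Submodule.span ℂ (Set.range
        (fun p : {IJ : (Fin (n + 1) → ℕ) × (Fin (n + 1) → ℕ) //
            StrictMono IJ.1 ∧ StrictMono IJ.2} => dDet n p.1.1 p.1.2)) = Un n := by
  constructor
  · rw [linearIndependent_iff']
    intro s g hg p hp
    have := congrArg (coeff (∑ r, Finsupp.single (p.1.1 r, p.1.2 r) 1)) hg
    rw [coeff_sum, coeff_zero, Finset.sum_eq_single p] at this
    · rw [coeff_smul, aux_coeff_dDet p.2.1 p.2.2 p.2.1 p.2.2] at this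
      simpa using this
    · intro q _ hq
      rw [coeff_smul, aux_coeff_dDet p.2.1 p.2.2 q.2.1 q.2.2, if_neg, smul_zero]
      rintro ⟨a, b⟩
      exact hq (Subtype.ext (Prod.ext a b))
    · intro h
      exact absurd hp h
  · unfold Un
    congr 1
    ext x
    constructor
    · rintro ⟨p, rfl⟩
      exact ⟨p.1.1, p.1.2, p.2.1, p.2.2, rfl⟩
    · rintro ⟨I, J, hI, hJ, rfl⟩
      exact ⟨⟨(I, J), hI, hJ⟩, rfl⟩
end
end

section
/- For every n ≥ 1: the intersection of U_n with the weight-k homogeneous component of R is zero for every k < (n+1)², and is equal to the line ℂ·d_0 for k = (n+1)². (Hence d_0 is, up to scalar, the unique element of U_n of minimal weight (n+1)².) -/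
open MvPolynomial

noncomputable section

theorem aux_le (n : ℕ) (I : Fin (n + 1) → ℕ) (hI : StrictMono I) (r : Fin (n + 1)) :
    (r : ℕ) ≤ I r := by
  obtain ⟨r, hr⟩ := r
  induction r with
  | zero => exact Nat.zero_le _
  | succ m ih =>
    have h1 := ih (by omega)
    have h2 : I ⟨m, by omega⟩ < I ⟨m + 1, hr⟩ := hI (by simp)
    simp only at h1 ⊢
    omega

theorem aux_sum_iot (n : ℕ) : (∑ r, iot n r) + (∑ r, iot n r) + (n + 1) = (n + 1) ^ 2 := by
  have h : ∑ r, iot n r = ∑ i ∈ Finset.range (n + 1), i :=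
    Fin.sum_univ_eq_sum_range (fun i => i) (n + 1)
  have h2 := Finset.sum_range_id_mul_two (n + 1)
  rw [h]
  simp only [Nat.add_sub_cancel] at h2
  nlinarith

theorem aux_sum_le (n : ℕ) (I : Fin (n + 1) → ℕ) (hI : StrictMono I) :
    ∑ r, iot n r ≤ ∑ r, I r :=
  Finset.sum_le_sum fun r _ => aux_le n I hI r

theorem aux_sum_eq (n : ℕ) (I : Fin (n + 1) → ℕ) (hI : StrictMono I)
    (h : ∑ r, iot n r = ∑ r, I r) : I = iot n := by
  funext r
  exact ((Finset.sum_eq_sum_iff_of_le fun r _ => aux_le n I hI r).1 h r (Finset.mem_univ r)).symm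

theorem aux_hom (n : ℕ) (I J : Fin (n + 1) → ℕ) :
    IsWeightedHomogeneous (fun ab : ℕ × ℕ => ab.1 + ab.2 + 1) (dDet n I J)
      ((∑ r, I r) + (∑ r, J r) + (n + 1)) := by
  rw [← mem_weightedHomogeneousSubmodule ℂ]
  unfold dDet
  rw [Matrix.det_apply]
  refine Submodule.sum_mem _ fun σ _ => ?_
  have key : (∏ i, (X (I (σ i), J i) : RR)) ∈
      weightedHomogeneousSubmodule ℂ (fun ab : ℕ × ℕ => ab.1 + ab.2 + 1)
      ((∑ r, I r) + (∑ r, J r) + (n + 1)) := by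
    rw [mem_weightedHomogeneousSubmodule]
    have h := IsWeightedHomogeneous.prod (R := ℂ) (w := fun ab : ℕ × ℕ => ab.1 + ab.2 + 1)
      Finset.univ (fun i => (X (I (σ i), J i) : RR)) (fun i => I (σ i) + J i + 1)
      (fun i _ => isWeightedHomogeneous_X ℂ _ _)
    convert h using 1
    simp only [Finset.sum_add_distrib, Equiv.sum_comp σ I]
    simp
  rcases Int.units_eq_one_or (Equiv.Perm.sign σ) with h | h
  · rw [h, one_smul]; exact key
  · rw [h, Units.neg_smul, one_smul]; exact Submodule.neg_mem _ key

theorem aux_main (n k : ℕ) (S : Submodule ℂ RR)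
    (hS : ∀ I J : Fin (n + 1) → ℕ, StrictMono I → StrictMono J →
      (∑ r, I r) + (∑ r, J r) + (n + 1) = k → dDet n I J ∈ S) :
    Un n ⊓ weightedHomogeneousSubmodule ℂ (fun ab : ℕ × ℕ => ab.1 + ab.2 + 1) k ≤ S := by
  rintro x ⟨hx, hk⟩
  have h : Un n ≤ S.comap (weightedHomogeneousComponent (fun ab : ℕ × ℕ => ab.1 + ab.2 + 1) k) := by
    refine Submodule.span_le.2 ?_
    rintro _ ⟨I, J, hI, hJ, rfl⟩
    rw [SetLike.mem_coe, Submodule.mem_comap]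
    by_cases e : (∑ r, I r) + (∑ r, J r) + (n + 1) = k
    · have h := aux_hom n I J
      rw [e] at h
      rw [h.weightedHomogeneousComponent_same]
      exact hS I J hI hJ e
    · rw [(aux_hom n I J).weightedHomogeneousComponent_ne _ (Ne.symm e)]
      exact S.zero_mem
  have h2 := h hx
  rw [Submodule.mem_comap, IsWeightedHomogeneous.weightedHomogeneousComponent_same hk] at h2
  exact h2

/-- With respect to the grading of `R` in which `Q_{a,b}` has weight `a+b+1`: the
intersection of `U_n` with the weight-`k` homogeneous component is `0` for `k < (n+1)²`
and equals the line `ℂ·d_0` for `k = (n+1)²`. Hence `d_0` is, up to scalar, the unique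
element of `U_n` of minimal weight `(n+1)²`. -/
theorem Un_weight_components (n : ℕ) (hn : 1 ≤ n) :
    (∀ k : ℕ, k < (n + 1) ^ 2 →
      Un n ⊓ weightedHomogeneousSubmodule ℂ (fun ab : ℕ × ℕ => ab.1 + ab.2 + 1) k = ⊥) ∧
    Un n ⊓ weightedHomogeneousSubmodule ℂ (fun ab : ℕ × ℕ => ab.1 + ab.2 + 1) ((n + 1) ^ 2) =
      Submodule.span ℂ {dDet n (iot n) (iot n)} := by
  have h0 := aux_sum_iot n
  have mono : StrictMono (iot n) := fun a b h => h
  refine ⟨fun k hk => ?_, le_antisymm ?_ ?_⟩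
  · rw [eq_bot_iff]
    refine aux_main n k ⊥ fun I J hI hJ e => ?_
    have h1 := aux_sum_le n I hI
    have h2 := aux_sum_le n J hJ
    omega
  · refine aux_main n _ _ fun I J hI hJ e => ?_
    have h1 := aux_sum_le n I hI
    have h2 := aux_sum_le n J hJ
    rw [aux_sum_eq n I hI (by omega), aux_sum_eq n J hJ (by omega)]
    exact Submodule.mem_span_singleton_self _
  · rw [Submodule.span_singleton_le_iff_mem]
    refine ⟨Submodule.subset_span ⟨_, _, mono, mono, rfl⟩, ?_⟩
    have h := aux_hom n (iot n) (iot n)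
    rw [h0] at h
    exact h
end
end
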